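/- Suppose there exist constants c, C > 0 and κ ≥ 0 such that the eigenvalues λ_i² of B = V^{1/2} A V^{1/2} (equivalently of VA) satisfy c i^κ ≤ λ_i ≤ C i^κ for i = 1,…,d, that ψ_d(x) := φ_d(V^{1/2}x) satisfies Assumption 1 with the norms |x|_s := |B^s x|, and that r = max{s, s', s''} satisfies Assumption 2 (with λ_i the eigenvalues of B). If h = l² d^{−1/3−2κ} for some l > 0 and τ = lim_{d→∞} d^{−6κ−1} Σ_{i=1}^d λ_i^6, then the generalized Langevin Metropolis–Hastings algorithm, in equilibrium (x ~ π_d), satisfies E[α(x,y)] → 2Φ(−l³|θ − ½|√τ/4) as d → ∞, and for q_i a normalized eigenvector of B corresponding to λ_i², E[|q_i^T V^{-1/2}(x' − x)|²] = 2hΦ(−l³|θ − ½|√τ/4) + o(h) as d → ∞. -/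

import Mathlib

open MeasureTheory ProbabilityTheory Matrix Filter Asymptotics
open scoped Topology

noncomputable section GLSetup

/-- The standard Gaussian measure `N(0, I)` on `ℝ^d`. -/
def stdGaussian (d : ℕ) : Measure (Fin d → ℝ) := Measure.pi fun _ => gaussianReal 0 1

/-- Product measure carrying the two independent standard Gaussian inputs. -/
def prodGaussian (d : ℕ) : Measure ((Fin d → ℝ) × (Fin d → ℝ)) :=
  (stdGaussian d).prod (stdGaussian d)

/-- Standard normal cumulative distribution function `Φ`. -/
def Phi (x : ℝ) : ℝ := (gaussianReal 0 1 (Set.Iic x)).toReal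

/-- Fractional power `B^s = Q diag(λ_i^{2s}) Qᵀ`. -/
def Bpow {d : ℕ} (Q : Matrix (Fin d) (Fin d) ℝ) (lam : Fin d → ℝ) (s : ℝ) :
    Matrix (Fin d) (Fin d) ℝ :=
  Q * Matrix.diagonal (fun i => lam i ^ (2 * s)) * Qᵀ

/-- The norm `|v|_s = |B^s v|` (Euclidean norm). -/
def snorm {d : ℕ} (Q : Matrix (Fin d) (Fin d) ℝ) (lam : Fin d → ℝ) (s : ℝ)
    (v : Fin d → ℝ) : ℝ :=
  Real.sqrt ((Bpow Q lam s).mulVec v ⬝ᵥ (Bpow Q lam s).mulVec v)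

/-- The equilibrium reference state `x = A⁻¹b + Rξ` with `R Rᵀ = A⁻¹`. -/
def xeq {d : ℕ} (A : Matrix (Fin d) (Fin d) ℝ) (b : Fin d → ℝ)
    (R : Matrix (Fin d) (Fin d) ℝ) (ξ : Fin d → ℝ) : Fin d → ℝ :=
  A⁻¹.mulVec b + R.mulVec ξ

/-- The mean of the generalized Langevin proposal from state `u`:
`(I + (θh/2)VA)⁻¹ [(I - ((1-θ)h/2)VA)u + (h/2)Vb]`. -/
def glMean {d : ℕ} (A V : Matrix (Fin d) (Fin d) ℝ) (b : Fin d → ℝ) (θ h : ℝ)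
    (u : Fin d → ℝ) : Fin d → ℝ :=
  (1 + (θ * h / 2) • (V * A))⁻¹.mulVec
    ((1 - ((1 - θ) * h / 2) • (V * A)).mulVec u + (h / 2) • V.mulVec b)

/-- The generalized Langevin proposal
`y = (I + (θh/2)VA)⁻¹ [(I - ((1-θ)h/2)VA)x + (h/2)Vb + (hV)^{1/2}ξ]`. -/
def yGL {d : ℕ} (A V Vh : Matrix (Fin d) (Fin d) ℝ) (b : Fin d → ℝ) (θ h : ℝ)
    (x η : Fin d → ℝ) : Fin d → ℝ :=
  glMean A V b θ h x
    + Real.sqrt h • ((1 + (θ * h / 2) • (V * A))⁻¹.mulVec (Vh.mulVec η))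

/-- The proposal covariance `Σ = (I + (θh/2)VA)⁻¹ (hV) (I + (θh/2)AV)⁻¹`. -/
def glCov {d : ℕ} (A V : Matrix (Fin d) (Fin d) ℝ) (θ h : ℝ) :
    Matrix (Fin d) (Fin d) ℝ :=
  (1 + (θ * h / 2) • (V * A))⁻¹ * (h • V) * (1 + (θ * h / 2) • (A * V))⁻¹

/-- Log proposal density (up to the normalising constant, which cancels in the
Metropolis–Hastings ratio): `log q(u,w) = -½(w - mean(u))ᵀ Σ⁻¹ (w - mean(u))`. -/
def glQlog {d : ℕ} (A V : Matrix (Fin d) (Fin d) ℝ) (b : Fin d → ℝ) (θ h : ℝ)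
    (u w : Fin d → ℝ) : ℝ :=
  -(1/2) * ((w - glMean A V b θ h u) ⬝ᵥ (glCov A V θ h)⁻¹.mulVec (w - glMean A V b θ h u))

/-- Log target density (up to the normalising constant):
`log π_d(z) = -½zᵀAz + bᵀz - φ_d(z)`. -/
def glPlog {d : ℕ} (A : Matrix (Fin d) (Fin d) ℝ) (b : Fin d → ℝ)
    (φ : (Fin d → ℝ) → ℝ) (z : Fin d → ℝ) : ℝ :=
  -(1/2) * (z ⬝ᵥ A.mulVec z) + b ⬝ᵥ z - φ z

/-- Metropolis–Hastings acceptance probability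
`α(x,y) = 1 ∧ (π_d(y)q(y,x))/(π_d(x)q(x,y))`. -/
def glAccept {d : ℕ} (A V : Matrix (Fin d) (Fin d) ℝ) (b : Fin d → ℝ)
    (φ : (Fin d → ℝ) → ℝ) (θ h : ℝ) (x y : Fin d → ℝ) : ℝ :=
  min 1 (Real.exp (glPlog A b φ y - glPlog A b φ x
    + glQlog A V b θ h y x - glQlog A V b θ h x y))

end GLSetup

/-! ### Standard Gaussian vectors -/

instance isProbabilityMeasure_stdGaussian_pi (d : ℕ) :
    IsProbabilityMeasure (_root_.stdGaussian d) := by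
  unfold _root_.stdGaussian; infer_instance

instance isProbabilityMeasure_prodGaussian (d : ℕ) : IsProbabilityMeasure (prodGaussian d) := by
  unfold prodGaussian; infer_instance

lemma measurePreserving_eval_stdGaussian {d : ℕ} (i : Fin d) :
    MeasurePreserving (fun x : Fin d → ℝ => x i) (_root_.stdGaussian d) (gaussianReal 0 1) :=
  measurePreserving_eval (fun _ : Fin d => gaussianReal 0 1) i

lemma iIndepFun_stdGaussian (d : ℕ) {f : ℝ → ℝ} (hf : AEMeasurable f (gaussianReal 0 1)) :
    iIndepFun (fun (i : Fin d) (x : Fin d → ℝ) => f (x i)) (_root_.stdGaussian d) :=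
  iIndepFun_pi (μ := fun _ : Fin d => gaussianReal 0 1) (X := fun _ => f) fun _ => hf

lemma stdGaussian_map_mulVec {d : ℕ} {O : Matrix (Fin d) (Fin d) ℝ} (hO : O * Oᵀ = 1) :
    MeasurePreserving (fun x : Fin d → ℝ => O *ᵥ x) (_root_.stdGaussian d)
      (_root_.stdGaussian d) := by
  have hO' : Oᵀ * O = 1 := mul_eq_one_comm.mp hO
  let e : EuclideanSpace ℝ (Fin d) ≃ₗᵢ[ℝ] EuclideanSpace ℝ (Fin d) :=
    { toFun := fun x => WithLp.toLp 2 (O *ᵥ x.ofLp)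
      invFun := fun x => WithLp.toLp 2 (Oᵀ *ᵥ x.ofLp)
      map_add' := fun x y => by simp [mulVec_add]
      map_smul' := fun a x => by simp [mulVec_smul]
      left_inv := fun x => by simp [hO']
      right_inv := fun x => by simp [hO]
      norm_map' := fun x => by
        have key : (O *ᵥ x.ofLp) ⬝ᵥ (O *ᵥ x.ofLp) = x.ofLp ⬝ᵥ x.ofLp := by
          rw [dotProduct_mulVec, vecMul_mulVec, hO', vecMul_one]
        simp only [dotProduct, ← sq] at key
        simp only [EuclideanSpace.norm_eq, Real.norm_eq_abs, sq_abs]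
        exact congrArg Real.sqrt key }
  have hmeas : Measurable fun x : Fin d → ℝ => O *ᵥ x := by fun_prop
  refine ⟨hmeas, ?_⟩
  have h1 : (_root_.stdGaussian d).map (WithLp.toLp 2)
      = ProbabilityTheory.stdGaussian (EuclideanSpace ℝ (Fin d)) := map_pi_eq_stdGaussian
  have h2 := stdGaussian_map e
  rw [← h1, Measure.map_map (by fun_prop) (by fun_prop)] at h2
  have h3 := congrArg (Measure.map (WithLp.ofLp (p := 2))) h2
  rw [Measure.map_map (by fun_prop) (by fun_prop),
    Measure.map_map (by fun_prop) (by fun_prop)] at h3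
  simpa [Function.comp_def, e] using h3

lemma hasGaussianLaw_stdGaussian (d : ℕ) :
    HasGaussianLaw (fun x : Fin d → ℝ => x) (_root_.stdGaussian d) := by
  refine iIndepFun.hasGaussianLaw (X := fun (i : Fin d) (x : Fin d → ℝ) => x i) (fun i => ?_)
    (iIndepFun_stdGaussian d aemeasurable_id)
  exact ⟨by rw [(measurePreserving_eval_stdGaussian i).map_eq]; infer_instance⟩

/-- `∑ vᵢ xᵢ` as a continuous linear functional. -/
noncomputable def dotCLM {d : ℕ} (v : Fin d → ℝ) : (Fin d → ℝ) →L[ℝ] ℝ :=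
  ∑ i, v i • ContinuousLinearMap.proj i

lemma dotCLM_apply {d : ℕ} (v x : Fin d → ℝ) : dotCLM v x = v ⬝ᵥ x := by
  simp [dotCLM, dotProduct]

lemma integrable_eval_mul {d : ℕ} {f : ℝ → ℝ} (hf : MemLp f 2 (gaussianReal 0 1)) (i j : Fin d) :
    Integrable (fun x : Fin d → ℝ => f (x i) * f (x j)) (_root_.stdGaussian d) :=
  (hf.comp_measurePreserving (measurePreserving_eval_stdGaussian i)).integrable_mul
    (hf.comp_measurePreserving (measurePreserving_eval_stdGaussian j))

lemma memLp_sum_eval {d : ℕ} {f : ℝ → ℝ} (hf : MemLp f 2 (gaussianReal 0 1)) (α : Fin d → ℝ) :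
    MemLp (fun x : Fin d → ℝ => ∑ i, α i * f (x i)) 2 (_root_.stdGaussian d) :=
  memLp_finsetSum _ fun i _ =>
    (hf.comp_measurePreserving (measurePreserving_eval_stdGaussian i)).const_mul (α i)

lemma integral_eval {d : ℕ} {f : ℝ → ℝ} (hf : AEStronglyMeasurable f (gaussianReal 0 1))
    (i : Fin d) : ∫ x, f (x i) ∂_root_.stdGaussian d = ∫ u, f u ∂gaussianReal 0 1 := by
  rw [← (measurePreserving_eval_stdGaussian i).map_eq,
    integral_map (measurable_pi_apply i).aemeasurable]
  rwa [(measurePreserving_eval_stdGaussian i).map_eq]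

/-- Orthogonality of centred functions of distinct coordinates. -/
lemma integral_sum_mul_sum {d : ℕ} {f : ℝ → ℝ} (hf : MemLp f 2 (gaussianReal 0 1))
    (h0 : ∫ u, f u ∂gaussianReal 0 1 = 0) (α β : Fin d → ℝ) :
    ∫ x, (∑ i, α i * f (x i)) * (∑ i, β i * f (x i)) ∂_root_.stdGaussian d
      = (∑ i, α i * β i) * ∫ u, f u ^ 2 ∂gaussianReal 0 1 := by
  have hij : ∀ i j : Fin d, ∫ x, f (x i) * f (x j) ∂_root_.stdGaussian d
      = if i = j then ∫ u, f u ^ 2 ∂gaussianReal 0 1 else 0 := by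
    intro i j
    split_ifs with h
    · subst h
      simp only [← sq]
      exact integral_eval (f := fun u => f u ^ 2) (hf.1.pow 2) i
    · have hi := (iIndepFun_stdGaussian d hf.1.aemeasurable).indepFun h
      have hm (i : Fin d) := (hf.comp_measurePreserving (measurePreserving_eval_stdGaussian i)).1
      have := hi.integral_fun_mul_eq_mul_integral (hm i) (hm j)
      rw [this, integral_eval hf.1, h0, zero_mul]
  simp_rw [Finset.sum_mul_sum, mul_mul_mul_comm]
  rw [integral_finsetSum _ fun i _ => integrable_finsetSum _ fun j _ =>
    (integrable_eval_mul hf i j).const_mul _, Finset.sum_mul]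
  refine Finset.sum_congr rfl fun i _ => ?_
  rw [integral_finsetSum _ fun j _ => (integrable_eval_mul hf i j).const_mul _]
  simp [integral_const_mul, hij]

lemma memLp_two_id_gaussian : MemLp (fun u : ℝ => u) 2 (gaussianReal 0 1) := 
  memLp_id_gaussianReal 2

lemma integral_sq_gaussian : ∫ u : ℝ, u ^ 2 ∂gaussianReal 0 1 = 1 := by
  have h := variance_fun_id_gaussianReal (μ := 0) (v := 1)
  rw [variance_of_integral_eq_zero (by fun_prop) (by simp [integral_id_gaussianReal])] at h
  simpa using h

lemma integral_dot_mul_dot {d : ℕ} (v w : Fin d → ℝ) :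
    ∫ x, (v ⬝ᵥ x) * (w ⬝ᵥ x) ∂_root_.stdGaussian d = v ⬝ᵥ w := by
  have := integral_sum_mul_sum (d := d) memLp_two_id_gaussian integral_id_gaussianReal v w
  rw [integral_sq_gaussian, mul_one] at this
  exact this

lemma memLp_dot {d : ℕ} (v : Fin d → ℝ) :
    MemLp (fun x : Fin d → ℝ => v ⬝ᵥ x) 2 (_root_.stdGaussian d) :=
  memLp_sum_eval memLp_two_id_gaussian v

lemma integral_dot {d : ℕ} (v : Fin d → ℝ) : ∫ x, v ⬝ᵥ x ∂_root_.stdGaussian d = 0 := by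
  have hint (i : Fin d) : Integrable (fun x : Fin d → ℝ => v i * x i) (_root_.stdGaussian d) :=
    ((memLp_two_id_gaussian.comp_measurePreserving
      (measurePreserving_eval_stdGaussian i)).integrable (by norm_num)).const_mul _
  simp only [dotProduct]
  rw [integral_finsetSum _ fun i _ => hint i]
  refine Finset.sum_eq_zero fun i _ => ?_
  rw [integral_const_mul, integral_eval (f := fun u => u) memLp_two_id_gaussian.1,
    integral_id_gaussianReal, mul_zero]

lemma covariance_dot {d : ℕ} (v w : Fin d → ℝ) :
    cov[fun x => v ⬝ᵥ x, fun x => w ⬝ᵥ x; _root_.stdGaussian d] = v ⬝ᵥ w := by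
  rw [covariance_eq_sub (memLp_dot v) (memLp_dot w), integral_dot, zero_mul, sub_zero]
  exact integral_dot_mul_dot v w

lemma hasGaussianLaw_dot_prod {d : ℕ} (v w : Fin d → ℝ) :
    HasGaussianLaw (fun x : Fin d → ℝ => (v ⬝ᵥ x, w ⬝ᵥ x)) (_root_.stdGaussian d) := by
  have := (hasGaussianLaw_stdGaussian d).map_fun ((dotCLM v).prod (dotCLM w))
  simpa [dotCLM_apply] using this

lemma indepFun_dot {d : ℕ} {v w : Fin d → ℝ} (h : v ⬝ᵥ w = 0) :
    IndepFun (fun x : Fin d → ℝ => v ⬝ᵥ x) (fun x => w ⬝ᵥ x) (_root_.stdGaussian d) :=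
  (hasGaussianLaw_dot_prod v w).indepFun_of_covariance_eq_zero ((covariance_dot v w).trans h)

/-- A linear functional of a standard Gaussian vector is a centred Gaussian. -/
lemma measurePreserving_dot {d : ℕ} (v : Fin d → ℝ) {ρ : ℝ} (hρ : v ⬝ᵥ v = ρ ^ 2) :
    MeasurePreserving (fun x : Fin d → ℝ => v ⬝ᵥ x) (_root_.stdGaussian d)
      ((gaussianReal 0 1).map (fun u => ρ * u)) := by
  refine ⟨by fun_prop, ?_⟩
  rw [(hasGaussianLaw_dot_prod v v).fst.map_eq_gaussianReal, gaussianReal_map_const_mul,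
    integral_dot, ← covariance_self (by fun_prop), covariance_dot, hρ]
  simp only [mul_zero, mul_one]
  congr 1
  ext
  simp [Real.coe_toNNReal _ (sq_nonneg ρ)]

lemma integral_comp_dot {d : ℕ} (v : Fin d → ℝ) {ρ : ℝ} (hρ : v ⬝ᵥ v = ρ ^ 2) {F : ℝ → ℝ}
    (hF : Measurable F) :
    ∫ x, F (v ⬝ᵥ x) ∂_root_.stdGaussian d = ∫ u, F (ρ * u) ∂gaussianReal 0 1 := by
  have h := measurePreserving_dot v hρ
  have h1 := integral_map (μ := _root_.stdGaussian d) h.measurable.aemeasurable (f := F)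
    hF.aestronglyMeasurable
  rw [h.map_eq, integral_map (by fun_prop) hF.aestronglyMeasurable] at h1
  exact h1.symm

lemma measurePreserving_dot_unit {d : ℕ} {w : Fin d → ℝ} (hw : w ⬝ᵥ w = 1) :
    MeasurePreserving (fun x : Fin d → ℝ => w ⬝ᵥ x) (_root_.stdGaussian d) (gaussianReal 0 1) := by
  simpa using measurePreserving_dot w (ρ := 1) (by simpa using hw)

/-! ### The Metropolis acceptance function -/

/-- The acceptance probability as a function of the log acceptance ratio. -/
noncomputable def mhAccept (u : ℝ) : ℝ := min 1 (Real.exp u)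

lemma mhAccept_nonneg (u : ℝ) : 0 ≤ mhAccept u := le_min zero_le_one (Real.exp_pos u).le

lemma mhAccept_le_one (u : ℝ) : mhAccept u ≤ 1 := min_le_left _ _

@[fun_prop]
lemma measurable_mhAccept : Measurable mhAccept := by unfold mhAccept; fun_prop

lemma mhAccept_of_nonneg {u : ℝ} (hu : 0 ≤ u) : mhAccept u = 1 :=
  min_eq_left (Real.one_le_exp hu)

lemma mhAccept_of_nonpos {u : ℝ} (hu : u ≤ 0) : mhAccept u = Real.exp u :=
  min_eq_right (Real.exp_le_one_iff.mpr hu)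

lemma mhAccept_sub_le (u v : ℝ) : mhAccept u - mhAccept v ≤ |u - v| := by
  rcases le_total u v with h | h
  · have : mhAccept u ≤ mhAccept v := min_le_min le_rfl (Real.exp_le_exp.mpr h)
    linarith [abs_nonneg (u - v)]
  · rcases le_total 0 v with hv | hv
    · have : mhAccept v = 1 := mhAccept_of_nonneg hv
      linarith [mhAccept_le_one u, abs_nonneg (u - v)]
    · have hv' : mhAccept v = Real.exp v := mhAccept_of_nonpos hv
      rw [abs_of_nonneg (by linarith)]
      by_cases h1 : 1 ≤ u - v
      · linarith [mhAccept_le_one u, mhAccept_nonneg v]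
      · have h2 : mhAccept u ≤ Real.exp u := min_le_right _ _
        have h3 := Real.add_one_le_exp (v - u)
        have h4 : Real.exp v = Real.exp u * Real.exp (v - u) := by rw [← Real.exp_add]; ring_nf
        have h5 : mhAccept u * Real.exp (v - u) ≤ Real.exp v := by
          rw [h4]; exact mul_le_mul_of_nonneg_right h2 (Real.exp_pos _).le
        have h6 := mhAccept_le_one u
        have h7 := mhAccept_nonneg u
        rw [hv']
        nlinarith

lemma abs_mhAccept_sub_le (u v : ℝ) : |mhAccept u - mhAccept v| ≤ |u - v| := by
  rw [abs_le]
  have h1 := mhAccept_sub_le u v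
  have h2 := mhAccept_sub_le v u
  rw [abs_sub_comm] at h2
  constructor <;> linarith

lemma abs_mhAccept_sub_le_min (u v : ℝ) : |mhAccept u - mhAccept v| ≤ min 1 |u - v| := by
  refine le_min ?_ (abs_mhAccept_sub_le u v)
  rw [abs_le]
  constructor <;>
    linarith [mhAccept_nonneg u, mhAccept_le_one u, mhAccept_nonneg v, mhAccept_le_one v]

lemma integrable_mhAccept {Ω : Type*} [MeasurableSpace Ω] {μ : Measure Ω} [IsFiniteMeasure μ]
    {X : Ω → ℝ} (hX : Measurable X) : Integrable (fun ω => mhAccept (X ω)) μ :=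
  Integrable.of_bound (measurable_mhAccept.comp hX).aestronglyMeasurable 1 (ae_of_all _ fun ω => by
    rw [Real.norm_eq_abs, abs_of_nonneg (mhAccept_nonneg _)]; exact mhAccept_le_one _)

lemma gaussianPDFReal_mul_exp (σ x : ℝ) :
    Real.exp (σ * x - σ ^ 2 / 2) * gaussianPDFReal 0 1 x = gaussianPDFReal σ 1 x := by
  simp only [gaussianPDFReal, NNReal.coe_one, mul_one]
  rw [mul_left_comm, ← Real.exp_add]
  congr 2
  ring

lemma gaussianReal_Iic_eq (σ a : ℝ) : (gaussianReal σ 1).real (Set.Iic a) = Phi (a - σ) := by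
  have h := gaussianReal_map_const_add (μ := 0) (v := 1) σ
  rw [zero_add] at h
  rw [← h, map_measureReal_apply (by fun_prop) measurableSet_Iic, Phi, measureReal_def]
  congr 2
  ext x
  simp [le_sub_iff_add_le, add_comm]

lemma gaussianReal_Ioi_eq (a : ℝ) : (gaussianReal 0 1).real (Set.Ioi a) = Phi (-a) := by
  have h := gaussianReal_map_neg (μ := 0) (v := 1)
  rw [neg_zero] at h
  rw [Phi, ← measureReal_def]
  conv_rhs => rw [← h, map_measureReal_apply (by fun_prop) measurableSet_Iic]
  have hpre : (fun x : ℝ => -x) ⁻¹' Set.Iic (-a) = Set.Ici a := by ext x; simp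
  have : NullSingletonClass (gaussianReal 0 1) := nullSingletonClass_gaussianReal one_ne_zero
  rw [hpre]
  exact measureReal_congr Ioi_ae_eq_Ici

/-- The expected acceptance probability for a log ratio `N(-σ²/2, σ²)`. -/
lemma integral_mhAccept_gaussian {σ : ℝ} (hσ : 0 ≤ σ) :
    ∫ x, mhAccept (σ * x - σ ^ 2 / 2) ∂gaussianReal 0 1 = 2 * Phi (-(σ / 2)) := by
  rw [← integral_add_compl measurableSet_Iic (integrable_mhAccept (by fun_prop))
    (s := Set.Iic (σ / 2)),
    Set.compl_Iic, two_mul]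
  congr 1
  · rw [setIntegral_congr_fun (g := fun x => Real.exp (σ * x - σ ^ 2 / 2)) measurableSet_Iic
      fun x (hx : x ≤ σ / 2) => mhAccept_of_nonpos (by
        have := mul_le_mul_of_nonneg_left hx hσ
        nlinarith)]
    have : -(σ / 2) = σ / 2 - σ := by ring
    rw [this, ← gaussianReal_Iic_eq, measureReal_def, gaussianReal_apply_eq_integral _ one_ne_zero,
      ENNReal.toReal_ofReal (setIntegral_nonneg measurableSet_Iic fun x _ =>
        gaussianPDFReal_nonneg _ _ _), ← integral_indicator measurableSet_Iic,
      integral_gaussianReal_eq_integral_smul one_ne_zero, ← integral_indicator measurableSet_Iic]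
    refine integral_congr_ae (ae_of_all _ fun x => ?_)
    simp only [Set.indicator, smul_eq_mul]
    split_ifs
    · rw [mul_comm, gaussianPDFReal_mul_exp]
    · simp
  · rcases hσ.eq_or_lt with rfl | hpos
    · simp only [mhAccept]
      have h := gaussianReal_Ioi_eq 0
      rw [neg_zero] at h
      simp [h]
    · rw [setIntegral_congr_fun (g := fun _ => (1 : ℝ)) measurableSet_Ioi
        fun x (hx : σ / 2 < x) => mhAccept_of_nonneg (by
          have := mul_lt_mul_of_pos_left hx hpos
          nlinarith)]
      simp [gaussianReal_Ioi_eq]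

/-! ### Gaussian conditioning on the current state -/

lemma integral_abs_mul_abs_le_sqrt {Ω : Type*} [MeasurableSpace Ω] {μ : Measure Ω} {f g : Ω → ℝ}
    (hf : MemLp f 2 μ) (hg : MemLp g 2 μ) :
    ∫ ω, |f ω| * |g ω| ∂μ ≤ √(∫ ω, f ω ^ 2 ∂μ) * √(∫ ω, g ω ^ 2 ∂μ) := by
  have h := integral_mul_norm_le_Lp_mul_Lq (μ := μ) (f := f) (g := g) Real.HolderConjugate.two_two
    (by simpa using hf) (by simpa using hg)
  simpa [Real.sqrt_eq_rpow] using h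

lemma integral_abs_le_sqrt {Ω : Type*} [MeasurableSpace Ω] {μ : Measure Ω}
    [IsProbabilityMeasure μ] {f : Ω → ℝ} (hf : MemLp f 2 μ) :
    ∫ ω, |f ω| ∂μ ≤ √(∫ ω, f ω ^ 2 ∂μ) := by
  simpa using integral_abs_mul_abs_le_sqrt hf (memLp_const (1 : ℝ))

lemma integral_sqrt_le_sqrt {Ω : Type*} [MeasurableSpace Ω] {μ : Measure Ω}
    [IsProbabilityMeasure μ] {f : Ω → ℝ} (hf : Integrable f μ) (h0 : ∀ ω, 0 ≤ f ω) :
    Integrable (fun ω => √(f ω)) μ ∧ ∫ ω, √(f ω) ∂μ ≤ √(∫ ω, f ω ∂μ) := by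
  have hm : MemLp (fun ω => √(f ω)) 2 μ := by
    rw [memLp_two_iff_integrable_sq (Real.continuous_sqrt.comp_aestronglyMeasurable hf.1)]
    simpa [Real.sq_sqrt (h0 _)] using hf
  refine ⟨hm.integrable (by norm_num), ?_⟩
  have h := integral_abs_le_sqrt hm
  simpa only [Real.sq_sqrt (h0 _), abs_of_nonneg (Real.sqrt_nonneg _)] using h

lemma abs_sub_le_sqrt_abs_sq_sub_sq {a b : ℝ} (ha : 0 ≤ a) (hb : 0 ≤ b) :
    |a - b| ≤ √|a ^ 2 - b ^ 2| := by
  apply Real.le_sqrt_of_sq_le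
  rw [sq_sub_sq, abs_mul, sq, abs_of_nonneg (add_nonneg ha hb)]
  refine mul_le_mul_of_nonneg_right ?_ (abs_nonneg _)
  rw [abs_le]; constructor <;> linarith

lemma abs_integral_mhAccept_gaussian_sub_le {ρ σ c : ℝ} :
    |∫ x, mhAccept (ρ * x - c) ∂gaussianReal 0 1 - ∫ x, mhAccept (σ * x - c) ∂gaussianReal 0 1|
      ≤ |ρ - σ| := by
  have hid : MemLp (fun u : ℝ => u) 2 (gaussianReal 0 1) := memLp_two_id_gaussian
  rw [← integral_sub (integrable_mhAccept (by fun_prop)) (integrable_mhAccept (by fun_prop))]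
  calc _ ≤ ∫ x, |ρ - σ| * |x| ∂gaussianReal 0 1 := by
        refine (abs_integral_le_integral_abs).trans (integral_mono_of_nonneg
          (ae_of_all _ fun _ => abs_nonneg _)
          ((hid.integrable (by norm_num)).abs.const_mul _) (ae_of_all _ fun x => ?_))
        refine (abs_mhAccept_sub_le _ _).trans (le_of_eq ?_)
        simp only
        rw [← abs_mul]; congr 1; ring
    _ ≤ |ρ - σ| * 1 := by
        rw [integral_const_mul]
        refine mul_le_mul_of_nonneg_left ?_ (abs_nonneg _)
        have := integral_abs_le_sqrt hid
        rwa [integral_sq_gaussian, Real.sqrt_one] at this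
    _ = _ := mul_one _

section
variable {d : ℕ} {w : Fin d → ℝ} {p : ℝ → ℝ} {σ : ℝ}

lemma memLp_comp_dot (hw : w ⬝ᵥ w = 1) (hp : MemLp p 2 (gaussianReal 0 1)) :
    MemLp (fun x : Fin d → ℝ => p (w ⬝ᵥ x)) 2 (_root_.stdGaussian d) :=
  hp.comp_measurePreserving (measurePreserving_dot_unit hw)

lemma integral_sq_comp_dot (hw : w ⬝ᵥ w = 1) (hpm : Measurable p) :
    ∫ x, p (w ⬝ᵥ x) ^ 2 ∂_root_.stdGaussian d = ∫ u, p u ^ 2 ∂gaussianReal 0 1 := by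
  simpa using integral_comp_dot w (ρ := 1) (by simpa using hw) (hpm.pow_const 2)

/-- A linear statistic `v ⬝ η` of variance close to `σ²`, weighted by a function of another, nearly
uncorrelated, linear statistic `w ⬝ η`. -/
lemma abs_integral_weighted_mhAccept_sub_le (hw : w ⬝ᵥ w = 1) (hpm : Measurable p)
    (hp : MemLp p 2 (gaussianReal 0 1)) (h1 : ∫ u, p u ∂gaussianReal 0 1 = 1) (hσ : 0 ≤ σ)
    (v : Fin d → ℝ) :
    |∫ x, p (w ⬝ᵥ x) * mhAccept (v ⬝ᵥ x - σ ^ 2 / 2) ∂_root_.stdGaussian d - 2 * Phi (-(σ / 2))|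
      ≤ √(∫ u, p u ^ 2 ∂gaussianReal 0 1) * |w ⬝ᵥ v| + √(|v ⬝ᵥ v - σ ^ 2| + (w ⬝ᵥ v) ^ 2) := by
  set v' := v - (w ⬝ᵥ v) • w with hv'
  have hwv' : w ⬝ᵥ v' = 0 := by simp [hv', dotProduct_sub, hw]
  have hvv' : v' ⬝ᵥ v' = v ⬝ᵥ v - (w ⬝ᵥ v) ^ 2 := by
    have : v' ⬝ᵥ v' = v' ⬝ᵥ v := by
      nth_rw 2 [hv']
      rw [dotProduct_sub, dotProduct_smul, dotProduct_comm v' w, hwv', smul_zero, sub_zero]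
    rw [this, hv', sub_dotProduct, smul_dotProduct, smul_eq_mul, sq]
  have hv'0 : 0 ≤ v' ⬝ᵥ v' := by
    simp only [dotProduct]; exact Finset.sum_nonneg fun i _ => mul_self_nonneg _
  set ρ := √(v' ⬝ᵥ v') with hρ
  have hρ2 : v' ⬝ᵥ v' = ρ ^ 2 := (Real.sq_sqrt hv'0).symm
  have hL := memLp_comp_dot hw hp
  have hint (u : Fin d → ℝ) : Integrable
      (fun x => p (w ⬝ᵥ x) * mhAccept (u ⬝ᵥ x - σ ^ 2 / 2)) (_root_.stdGaussian d) :=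
    (hL.integrable (by norm_num)).mul_bdd (c := 1)
      (measurable_mhAccept.comp (by fun_prop)).aestronglyMeasurable (ae_of_all _ fun x => by
        rw [Real.norm_eq_abs, abs_of_nonneg (mhAccept_nonneg _)]; exact mhAccept_le_one _)
  have e1 : ∫ x, p (w ⬝ᵥ x) * mhAccept (v' ⬝ᵥ x - σ ^ 2 / 2) ∂_root_.stdGaussian d
      = ∫ x, mhAccept (ρ * x - σ ^ 2 / 2) ∂gaussianReal 0 1 := by
    have hi := (indepFun_dot hwv').comp hpm
      (measurable_mhAccept.comp (measurable_id.sub_const (σ ^ 2 / 2)))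
    have := hi.integral_fun_mul_eq_mul_integral (hpm.comp (by fun_prop)).aestronglyMeasurable
      ((measurable_mhAccept.comp (measurable_id.sub_const (σ ^ 2 / 2))).comp
        (by fun_prop)).aestronglyMeasurable
    simp only [Function.comp_apply, id] at this
    rw [this, integral_comp_dot w (ρ := 1) (by simpa using hw) hpm,
      integral_comp_dot v' hρ2 (F := fun u => mhAccept (u - σ ^ 2 / 2))
        (measurable_mhAccept.comp (by fun_prop))]
    simp [h1]
  have e2 : |∫ x, p (w ⬝ᵥ x) * mhAccept (v ⬝ᵥ x - σ ^ 2 / 2) ∂_root_.stdGaussian d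
      - ∫ x, p (w ⬝ᵥ x) * mhAccept (v' ⬝ᵥ x - σ ^ 2 / 2) ∂_root_.stdGaussian d|
      ≤ √(∫ u, p u ^ 2 ∂gaussianReal 0 1) * |w ⬝ᵥ v| := by
    rw [← integral_sub (hint v) (hint v')]
    calc _ ≤ ∫ x, |w ⬝ᵥ v| * (|p (w ⬝ᵥ x)| * |w ⬝ᵥ x|) ∂_root_.stdGaussian d := by
          refine (abs_integral_le_integral_abs).trans (integral_mono_of_nonneg
            (ae_of_all _ fun _ => abs_nonneg _)
            ((hL.abs.integrable_mul (memLp_dot w).abs).const_mul _) (ae_of_all _ fun x => ?_))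
          simp only
          rw [← mul_sub, abs_mul, mul_left_comm]
          refine mul_le_mul_of_nonneg_left ((abs_mhAccept_sub_le _ _).trans (le_of_eq ?_))
            (abs_nonneg _)
          rw [← abs_mul, hv', sub_dotProduct, smul_dotProduct, smul_eq_mul]
          congr 1; ring
      _ ≤ |w ⬝ᵥ v| * (√(∫ u, p u ^ 2 ∂gaussianReal 0 1) * 1) := by
          rw [integral_const_mul]
          refine mul_le_mul_of_nonneg_left ?_ (abs_nonneg _)
          have := integral_abs_mul_abs_le_sqrt hL (memLp_dot w)
          rw [integral_sq_comp_dot hw hpm] at this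
          simpa only [sq (w ⬝ᵥ _), integral_dot_mul_dot, hw, Real.sqrt_one] using this
      _ = _ := by ring
  have e3 : |∫ x, mhAccept (ρ * x - σ ^ 2 / 2) ∂gaussianReal 0 1 - 2 * Phi (-(σ / 2))|
      ≤ √(|v ⬝ᵥ v - σ ^ 2| + (w ⬝ᵥ v) ^ 2) := by
    rw [← integral_mhAccept_gaussian hσ]
    refine abs_integral_mhAccept_gaussian_sub_le.trans
      ((abs_sub_le_sqrt_abs_sq_sub_sq (Real.sqrt_nonneg _) hσ).trans (Real.sqrt_le_sqrt ?_))
    rw [← hρ2, hvv', sub_right_comm]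
    exact (abs_sub _ _).trans (by rw [abs_of_nonneg (sq_nonneg (w ⬝ᵥ v))])
  rw [e1] at e2
  exact (abs_sub_le _ _ _).trans (add_le_add e2 e3)

end

lemma memLp_sq_sub_one_gaussian : MemLp (fun u : ℝ => u ^ 2 - 1) 2 (gaussianReal 0 1) := by
  have h4 : MemLp (fun u : ℝ => u) 4 (gaussianReal 0 1) := memLp_id_gaussianReal 4
  have : MemLp (fun u : ℝ => u ^ 2) 2 (gaussianReal 0 1) := by
    rw [memLp_two_iff_integrable_sq (by fun_prop)]
    have := h4.integrable_norm_pow (p := 4) (by norm_num)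
    refine this.congr (ae_of_all _ fun u => ?_)
    simp only [Real.norm_eq_abs]
    rw [← pow_mul]
    exact (show Even 4 by decide).pow_abs u
  exact this.sub (memLp_const 1)

lemma integral_sq_sub_one_gaussian : ∫ u : ℝ, (u ^ 2 - 1) ∂gaussianReal 0 1 = 0 := by
  rw [integral_sub memLp_two_id_gaussian.integrable_sq (integrable_const _), integral_sq_gaussian]
  simp

/-- The variance of the square of a standard Gaussian variable. -/
noncomputable def gaussianSqVar : ℝ := ∫ u : ℝ, (u ^ 2 - 1) ^ 2 ∂gaussianReal 0 1

lemma gaussianSqVar_nonneg : 0 ≤ gaussianSqVar := integral_nonneg fun _ => sq_nonneg _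

lemma integral_sq_sum_sq_sub_one {d : ℕ} (α : Fin d → ℝ) :
    ∫ x, (∑ i, α i * (x i ^ 2 - 1)) ^ 2 ∂_root_.stdGaussian d = (∑ i, α i ^ 2) * gaussianSqVar := by
  simpa only [sq (∑ i, _), ← sq (α _), gaussianSqVar] using
    integral_sum_mul_sum memLp_sq_sub_one_gaussian integral_sq_sub_one_gaussian α α

lemma memLp_sum_sq_sub_one {d : ℕ} (α : Fin d → ℝ) :
    MemLp (fun x : Fin d → ℝ => ∑ i, α i * (x i ^ 2 - 1)) 2 (_root_.stdGaussian d) :=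
  memLp_sum_eval memLp_sq_sub_one_gaussian α

lemma sum_mul_le_of_sq_le {d : ℕ} {a : Fin d → ℝ} {ε : ℝ} (ha : ∀ i, a i ^ 2 ≤ ε ^ 2)
    (b : Fin d → ℝ) : ∑ i, a i ^ 2 * b i ^ 2 ≤ ε ^ 2 * ∑ i, b i ^ 2 := by
  rw [Finset.mul_sum]
  exact Finset.sum_le_sum fun i _ => mul_le_mul_of_nonneg_right (ha i) (sq_nonneg _)

section
variable {d : ℕ} {w a : Fin d → ℝ} {p : ℝ → ℝ} {σ ε m : ℝ} {H : (Fin d → ℝ) → ℝ}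

/-- Averaging `abs_integral_weighted_mhAccept_sub_le` over the current state. -/
lemma abs_integral_prod_mhAccept_sub_le (hw : w ⬝ᵥ w = 1) (hpm : Measurable p)
    (hp : MemLp p 2 (gaussianReal 0 1)) (h1 : ∫ u, p u ∂gaussianReal 0 1 = 1) (hσ : 0 ≤ σ)
    (hε : 0 ≤ ε) (ha : ∀ i, |a i| ≤ ε) (hH : Measurable H) (hm : ∀ x, m ≤ H x)
    (hH1 : ∫ x, Real.exp (-H x) ∂_root_.stdGaussian d = 1) :
    |∫ ω, p (w ⬝ᵥ ω.2) * mhAccept (∑ i, a i * ω.1 i * ω.2 i - σ ^ 2 / 2) * Real.exp (-H ω.1)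
        ∂prodGaussian d - 2 * Phi (-(σ / 2))|
      ≤ Real.exp (-m) * (√(∫ u, p u ^ 2 ∂gaussianReal 0 1) * ε
        + √(√(ε ^ 2 * (∑ i, a i ^ 2) * gaussianSqVar) + |∑ i, a i ^ 2 - σ ^ 2| + ε ^ 2)) := by
  have ha2 (i : Fin d) : a i ^ 2 ≤ ε ^ 2 := sq_le_sq' (abs_le.mp (ha i)).1 (abs_le.mp (ha i)).2
  have hexp (x : Fin d → ℝ) : Real.exp (-H x) ≤ Real.exp (-m) :=
    Real.exp_le_exp.mpr (neg_le_neg (hm x))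
  have hexpint : Integrable (fun x => Real.exp (-H x)) (_root_.stdGaussian d) :=
    Integrable.of_bound (by fun_prop) (Real.exp (-m)) (ae_of_all _ fun x => by
      rw [Real.norm_eq_abs, abs_of_pos (Real.exp_pos _)]; exact hexp x)
  let v (x : Fin d → ℝ) : Fin d → ℝ := fun i => a i * x i
  have hv (x y : Fin d → ℝ) : ∑ i, a i * x i * y i = v x ⬝ᵥ y := rfl
  let I (x : Fin d → ℝ) : ℝ :=
    ∫ y, p (w ⬝ᵥ y) * mhAccept (v x ⬝ᵥ y - σ ^ 2 / 2) ∂_root_.stdGaussian d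
  have hF : Integrable (fun ω : (Fin d → ℝ) × (Fin d → ℝ) =>
      p (w ⬝ᵥ ω.2) * mhAccept (∑ i, a i * ω.1 i * ω.2 i - σ ^ 2 / 2) * Real.exp (-H ω.1))
      ((_root_.stdGaussian d).prod (_root_.stdGaussian d)) := by
    have h0 : Integrable (fun ω : (Fin d → ℝ) × (Fin d → ℝ) => p (w ⬝ᵥ ω.2))
        ((_root_.stdGaussian d).prod (_root_.stdGaussian d)) :=
      ((memLp_comp_dot hw hp).integrable (by norm_num)).comp_snd _
    refine (h0.mul_bdd (c := 1) ?_ (ae_of_all _ fun x => ?_)).mul_bdd (c := Real.exp (-m)) ?_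
      (ae_of_all _ fun x => ?_)
    · exact (measurable_mhAccept.comp (by fun_prop)).aestronglyMeasurable
    · rw [Real.norm_eq_abs, abs_of_nonneg (mhAccept_nonneg _)]; exact mhAccept_le_one _
    · exact (hH.comp measurable_fst).neg.exp.aestronglyMeasurable
    · rw [Real.norm_eq_abs, abs_of_pos (Real.exp_pos _)]; exact hexp _
  have hIint : Integrable (fun x => I x * Real.exp (-H x)) (_root_.stdGaussian d) := by
    refine hF.integral_prod_left.congr (ae_of_all _ fun x => ?_)
    simp only [integral_mul_const, hv]; rfl
  have e1 : ∫ ω, p (w ⬝ᵥ ω.2) * mhAccept (∑ i, a i * ω.1 i * ω.2 i - σ ^ 2 / 2)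
      * Real.exp (-H ω.1) ∂prodGaussian d - 2 * Phi (-(σ / 2))
      = ∫ x, (I x - 2 * Phi (-(σ / 2))) * Real.exp (-H x) ∂_root_.stdGaussian d := by
    rw [prodGaussian, integral_prod _ hF]
    simp only [sub_mul]
    rw [integral_sub hIint (hexpint.const_mul _), integral_const_mul, hH1, mul_one]
    simp only [integral_mul_const, hv]; rfl
  let wa : Fin d → ℝ := fun i => w i * a i
  have hwv (x : Fin d → ℝ) : w ⬝ᵥ v x = wa ⬝ᵥ x := by simp [v, wa, dotProduct, mul_assoc]
  have hwa : wa ⬝ᵥ wa ≤ ε ^ 2 := by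
    have := sum_mul_le_of_sq_le ha2 w
    calc wa ⬝ᵥ wa = ∑ i, a i ^ 2 * w i ^ 2 := by
          simp only [wa, dotProduct]; exact Finset.sum_congr rfl fun i _ => by ring
      _ ≤ ε ^ 2 * (w ⬝ᵥ w) := by simpa only [dotProduct, ← sq] using this
      _ = ε ^ 2 := by rw [hw, mul_one]
  have hwasq : ∫ x, (wa ⬝ᵥ x) ^ 2 ∂_root_.stdGaussian d = wa ⬝ᵥ wa := by
    simp only [sq, integral_dot_mul_dot]
  let D (x : Fin d → ℝ) : ℝ := ∑ i, a i ^ 2 * (x i ^ 2 - 1)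
  have hD : MemLp D 2 (_root_.stdGaussian d) := memLp_sum_sq_sub_one fun i => a i ^ 2
  have hvv (x : Fin d → ℝ) : |v x ⬝ᵥ v x - σ ^ 2| ≤ |D x| + |∑ i, a i ^ 2 - σ ^ 2| := by
    have : v x ⬝ᵥ v x = D x + ∑ i, a i ^ 2 := by
      simp only [v, D, dotProduct, ← Finset.sum_add_distrib]
      exact Finset.sum_congr rfl fun i _ => by ring
    rw [this, add_sub_assoc]
    exact abs_add_le _ _
  let Z (x : Fin d → ℝ) : ℝ := |D x| + |∑ i, a i ^ 2 - σ ^ 2| + (wa ⬝ᵥ x) ^ 2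
  have hZ0 (x : Fin d → ℝ) : 0 ≤ Z x := by positivity
  have hDint := (hD.integrable (by norm_num)).abs
  have hDc : Integrable (fun x => |D x| + |∑ i, a i ^ 2 - σ ^ 2|) (_root_.stdGaussian d) :=
    hDint.add (integrable_const _)
  have hZint : Integrable Z (_root_.stdGaussian d) :=
    hDc.add (memLp_dot wa).integrable_sq
  have hZ : ∫ x, Z x ∂_root_.stdGaussian d
      ≤ √(ε ^ 2 * (∑ i, a i ^ 2) * gaussianSqVar) + |∑ i, a i ^ 2 - σ ^ 2| + ε ^ 2 := by
    simp only [Z]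
    rw [integral_add hDc (memLp_dot wa).integrable_sq,
      integral_add hDint (integrable_const _), hwasq, integral_const]
    simp only [probReal_univ, one_smul]
    refine add_le_add (add_le_add_left ?_ _) hwa
    refine (integral_abs_le_sqrt hD).trans (Real.sqrt_le_sqrt ?_)
    simp only [D]
    rw [integral_sq_sum_sq_sub_one]
    refine mul_le_mul_of_nonneg_right ?_ gaussianSqVar_nonneg
    refine le_trans (le_of_eq ?_) (sum_mul_le_of_sq_le ha2 a)
    exact Finset.sum_congr rfl fun i _ => sq _
  have hsq := integral_sqrt_le_sqrt hZint hZ0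
  have hwaint : Integrable (fun x => |wa ⬝ᵥ x|) (_root_.stdGaussian d) :=
    ((memLp_dot wa).integrable (by norm_num)).abs
  rw [e1]
  set S := √(∫ u, p u ^ 2 ∂gaussianReal 0 1) with hS
  have hS0 : 0 ≤ S := Real.sqrt_nonneg _
  calc _ ≤ ∫ x, Real.exp (-m) * (S * |wa ⬝ᵥ x| + √(Z x)) ∂_root_.stdGaussian d := by
        refine (abs_integral_le_integral_abs).trans (integral_mono_of_nonneg
          (ae_of_all _ fun _ => abs_nonneg _)
          (((hwaint.const_mul _).add hsq.1).const_mul _) (ae_of_all _ fun x => ?_))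
        simp only
        rw [abs_mul, abs_of_pos (Real.exp_pos _), mul_comm]
        refine mul_le_mul (hexp x) ?_ (abs_nonneg _) (Real.exp_pos _).le
        refine (abs_integral_weighted_mhAccept_sub_le hw hpm hp h1 hσ (v x)).trans ?_
        rw [hwv]
        refine add_le_add_right (Real.sqrt_le_sqrt ?_) _
        exact add_le_add_left (hvv x) _
    _ ≤ _ := by
        rw [integral_const_mul, integral_add (hwaint.const_mul _) hsq.1, integral_const_mul]
        refine mul_le_mul_of_nonneg_left ?_ (Real.exp_pos _).le
        refine add_le_add (mul_le_mul_of_nonneg_left ?_ hS0) (hsq.2.trans (Real.sqrt_le_sqrt hZ))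
        refine (integral_abs_le_sqrt (memLp_dot wa)).trans ?_
        rw [hwasq]
        exact Real.sqrt_le_iff.mpr ⟨hε, hwa⟩

end

/-! ### Autoregressive proposals in diagonal coordinates -/

/-- The proposal `gᵢ ξᵢ + kᵢ ηᵢ` in coordinates where the dynamics is diagonal. -/
def arProposal {d : ℕ} (g k : Fin d → ℝ) (ω : (Fin d → ℝ) × (Fin d → ℝ)) : Fin d → ℝ :=
  fun i => g i * ω.1 i + k i * ω.2 i

@[fun_prop]
lemma measurable_arProposal {d : ℕ} (g k : Fin d → ℝ) : Measurable (arProposal g k) := by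
  unfold arProposal; fun_prop

section
variable {d : ℕ}

lemma memLp_eval_stdGaussian (i : Fin d) :
    MemLp (fun x : Fin d → ℝ => x i) 2 (_root_.stdGaussian d) :=
  memLp_two_id_gaussian.comp_measurePreserving (measurePreserving_eval_stdGaussian i)

lemma memLp_linear_prod (a b : ℝ) (i : Fin d) :
    MemLp (fun ω : (Fin d → ℝ) × (Fin d → ℝ) => a * ω.1 i + b * ω.2 i) 2 (prodGaussian d) :=
  (((memLp_eval_stdGaussian i).comp_fst (_root_.stdGaussian d)).const_mul a).add
    (((memLp_eval_stdGaussian i).comp_snd (_root_.stdGaussian d)).const_mul b)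

lemma integral_linear_prod_sq (a b : ℝ) (i : Fin d) :
    ∫ ω, (a * ω.1 i + b * ω.2 i) ^ 2 ∂prodGaussian d = a ^ 2 + b ^ 2 := by
  have hx : MemLp (fun ω : (Fin d → ℝ) × (Fin d → ℝ) => ω.1 i) 2 (prodGaussian d) :=
    (memLp_eval_stdGaussian i).comp_fst (_root_.stdGaussian d)
  have hy : MemLp (fun ω : (Fin d → ℝ) × (Fin d → ℝ) => ω.2 i) 2 (prodGaussian d) :=
    (memLp_eval_stdGaussian i).comp_snd (_root_.stdGaussian d)
  have hsq : ∫ x : Fin d → ℝ, x i ^ 2 ∂_root_.stdGaussian d = 1 := by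
    rw [integral_eval (f := fun u => u ^ 2) (by fun_prop), integral_sq_gaussian]
  have ex : ∫ ω : (Fin d → ℝ) × (Fin d → ℝ), ω.1 i ^ 2 ∂prodGaussian d = 1 := by
    rw [prodGaussian, integral_fun_fst (f := fun x : Fin d → ℝ => x i ^ 2), hsq]; simp
  have ey : ∫ ω : (Fin d → ℝ) × (Fin d → ℝ), ω.2 i ^ 2 ∂prodGaussian d = 1 := by
    rw [prodGaussian, integral_fun_snd (f := fun x : Fin d → ℝ => x i ^ 2), hsq]; simp
  have exy : ∫ ω : (Fin d → ℝ) × (Fin d → ℝ), ω.1 i * ω.2 i ∂prodGaussian d = 0 := by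
    rw [prodGaussian, integral_prod_mul (fun x : Fin d → ℝ => x i) (fun x : Fin d → ℝ => x i),
      integral_eval (f := fun u => u) (by fun_prop), integral_id_gaussianReal, zero_mul]
  have h1 : Integrable (fun ω : (Fin d → ℝ) × (Fin d → ℝ) => a ^ 2 * ω.1 i ^ 2)
      (prodGaussian d) := hx.integrable_sq.const_mul _
  have h2 : Integrable (fun ω : (Fin d → ℝ) × (Fin d → ℝ) => 2 * a * b * (ω.1 i * ω.2 i))
      (prodGaussian d) := (hx.integrable_mul hy).const_mul _
  have h3 : Integrable (fun ω : (Fin d → ℝ) × (Fin d → ℝ) => b ^ 2 * ω.2 i ^ 2)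
      (prodGaussian d) := hy.integrable_sq.const_mul _
  have h12 : Integrable (fun ω : (Fin d → ℝ) × (Fin d → ℝ) =>
      a ^ 2 * ω.1 i ^ 2 + 2 * a * b * (ω.1 i * ω.2 i)) (prodGaussian d) := h1.add h2
  have heq (ω : (Fin d → ℝ) × (Fin d → ℝ)) : (a * ω.1 i + b * ω.2 i) ^ 2
      = a ^ 2 * ω.1 i ^ 2 + 2 * a * b * (ω.1 i * ω.2 i) + b ^ 2 * ω.2 i ^ 2 := by ring
  simp only [heq]
  rw [integral_add h12 h3, integral_add h1 h2, integral_const_mul, integral_const_mul,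
    integral_const_mul, ex, ey, exy]
  ring

lemma integrable_sum_linear_sq (c a b : Fin d → ℝ) :
    Integrable (fun ω : (Fin d → ℝ) × (Fin d → ℝ) =>
      ∑ i, c i * (a i * ω.1 i + b i * ω.2 i) ^ 2) (prodGaussian d) :=
  integrable_finsetSum _ fun i _ => (memLp_linear_prod (a i) (b i) i).integrable_sq.const_mul _

lemma integral_sum_linear_sq (c a b : Fin d → ℝ) :
    ∫ ω, ∑ i, c i * (a i * ω.1 i + b i * ω.2 i) ^ 2 ∂prodGaussian d
      = ∑ i, c i * (a i ^ 2 + b i ^ 2) := by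
  rw [integral_finsetSum _ fun i _ =>
    (memLp_linear_prod (a i) (b i) i).integrable_sq.const_mul _]
  simp only [integral_const_mul, integral_linear_prod_sq]

lemma min_one_abs_sq_le_one (u : ℝ) : min 1 |u| ^ 2 ≤ 1 :=
  pow_le_one₀ (le_min zero_le_one (abs_nonneg u)) (min_le_left _ _)

/-- A locally Lipschitz perturbation changes little over one step of the proposal. -/
lemma integral_min_one_abs_sub_sq_le {H : (Fin d → ℝ) → ℝ} {u u' g k : Fin d → ℝ}
    (hu : ∀ i, 0 ≤ u i) (hu' : ∀ i, 0 ≤ u' i) {δ : ℝ → ℝ → ℝ}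
    {K D : ℝ} (hK : 0 < K) (hδ : ∀ a b, |a| ≤ K → |b| ≤ K → δ a b ≤ D)
    (hlip : ∀ x y, |H x - H y| ≤ δ (√(∑ i, u i * x i ^ 2)) (√(∑ i, u i * y i ^ 2))
      * √(∑ i, u' i * (x i - y i) ^ 2)) :
    ∫ ω, min 1 |H ω.1 - H (arProposal g k ω)| ^ 2 ∂prodGaussian d
      ≤ (∑ i, u i + ∑ i, u i * (g i ^ 2 + k i ^ 2)) / K ^ 2
        + D ^ 2 * ∑ i, u' i * ((1 - g i) ^ 2 + k i ^ 2) := by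
  let X (ω : (Fin d → ℝ) × (Fin d → ℝ)) : ℝ := ∑ i, u i * (1 * ω.1 i + 0 * ω.2 i) ^ 2
  let Y (ω : (Fin d → ℝ) × (Fin d → ℝ)) : ℝ := ∑ i, u i * (g i * ω.1 i + k i * ω.2 i) ^ 2
  let E (ω : (Fin d → ℝ) × (Fin d → ℝ)) : ℝ :=
    ∑ i, u' i * ((1 - g i) * ω.1 i + -k i * ω.2 i) ^ 2
  have hX : Integrable X (prodGaussian d) := integrable_sum_linear_sq u (fun _ => 1) (fun _ => 0)
  have hY : Integrable Y (prodGaussian d) := integrable_sum_linear_sq u g k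
  have hE : Integrable E (prodGaussian d) :=
    integrable_sum_linear_sq u' (fun i => 1 - g i) (fun i => -k i)
  have iX : ∫ ω, X ω ∂prodGaussian d = ∑ i, u i := by
    refine (integral_sum_linear_sq u (fun _ => 1) (fun _ => 0)).trans ?_
    simp
  have iY : ∫ ω, Y ω ∂prodGaussian d = ∑ i, u i * (g i ^ 2 + k i ^ 2) :=
    integral_sum_linear_sq u g k
  have iE : ∫ ω, E ω ∂prodGaussian d = ∑ i, u' i * ((1 - g i) ^ 2 + k i ^ 2) := by
    refine (integral_sum_linear_sq u' (fun i => 1 - g i) (fun i => -k i)).trans ?_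
    simp
  have hXY : Integrable (fun ω => X ω + Y ω) (prodGaussian d) := hX.add hY
  calc _ ≤ ∫ ω, ((X ω + Y ω) / K ^ 2 + D ^ 2 * E ω) ∂prodGaussian d := by
        refine integral_mono_of_nonneg (ae_of_all _ fun _ => sq_nonneg _)
          ((hXY.div_const _).add (hE.const_mul _)) (ae_of_all _ fun ω => ?_)
        have hX0 : 0 ≤ X ω := Finset.sum_nonneg fun i _ => mul_nonneg (hu i) (sq_nonneg _)
        have hY0 : 0 ≤ Y ω := Finset.sum_nonneg fun i _ => mul_nonneg (hu i) (sq_nonneg _)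
        have hE0 : 0 ≤ E ω := Finset.sum_nonneg fun i _ => mul_nonneg (hu' i) (sq_nonneg _)
        simp only
        by_cases hc : X ω ≤ K ^ 2 ∧ Y ω ≤ K ^ 2
        · have h := hlip ω.1 (arProposal g k ω)
          have e1 : ∑ i, u i * ω.1 i ^ 2 = X ω := by simp [X]
          have e2 : ∑ i, u i * arProposal g k ω i ^ 2 = Y ω := rfl
          have e3 : ∑ i, u' i * (ω.1 i - arProposal g k ω i) ^ 2 = E ω := by
            simp only [E, arProposal]
            exact Finset.sum_congr rfl fun i _ => by ring
          rw [e1, e2, e3] at h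
          have hb {z : ℝ} (hz : z ≤ K ^ 2) : |√z| ≤ K := by
            rw [abs_of_nonneg (Real.sqrt_nonneg _)]
            exact Real.sqrt_le_iff.mpr ⟨hK.le, hz⟩
          have hD := hδ _ _ (hb hc.1) (hb hc.2)
          have h2 : |H ω.1 - H (arProposal g k ω)| ≤ D * √(E ω) :=
            h.trans (mul_le_mul_of_nonneg_right hD (Real.sqrt_nonneg _))
          have h3 : min 1 |H ω.1 - H (arProposal g k ω)| ^ 2 ≤ (D * √(E ω)) ^ 2 :=
            pow_le_pow_left₀ (le_min zero_le_one (abs_nonneg _)) ((min_le_right _ _).trans h2) 2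
          rw [mul_pow, Real.sq_sqrt hE0] at h3
          have : 0 ≤ (X ω + Y ω) / K ^ 2 := by positivity
          linarith
        · have h1 : 1 ≤ (X ω + Y ω) / K ^ 2 := by
            rw [le_div_iff₀ (by positivity), one_mul]
            rw [not_and_or, not_le, not_le] at hc
            rcases hc with hc | hc <;> linarith
          have h2 : 0 ≤ D ^ 2 * E ω := by positivity
          linarith [min_one_abs_sq_le_one (H ω.1 - H (arProposal g k ω))]
    _ = _ := by
        rw [integral_add (hXY.div_const _) (hE.const_mul _), integral_div, integral_add hX hY,
          integral_const_mul, iX, iY, iE]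

/-- The Gaussian contribution to the log acceptance ratio, split into its leading term (linear in
`η`), centred fluctuations, and its mean. -/
lemma sum_mul_arProposal_sq_sub (b g k : Fin d → ℝ) (ω : (Fin d → ℝ) × (Fin d → ℝ)) :
    ∑ i, b i * (arProposal g k ω i ^ 2 - ω.1 i ^ 2)
      = ∑ i, 2 * b i * g i * k i * ω.1 i * ω.2 i
        + ∑ i, b i * (g i ^ 2 - 1) * (ω.1 i ^ 2 - 1) + ∑ i, b i * k i ^ 2 * (ω.2 i ^ 2 - 1)
        + ∑ i, b i * (g i ^ 2 + k i ^ 2 - 1) := by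
  simp only [← Finset.sum_add_distrib, arProposal]
  exact Finset.sum_congr rfl fun i _ => by ring

lemma min_one_abs_add_sq_le (a b c e : ℝ) :
    min 1 |a + b + c + e| ^ 2 ≤ 4 * (a ^ 2 + b ^ 2 + c ^ 2 + min 1 |e| ^ 2) := by
  have h0 : 0 ≤ min 1 |e| := le_min zero_le_one (abs_nonneg e)
  have h : min 1 |a + b + c + e| ≤ |a| + |b| + |c| + min 1 |e| := by
    have h1 := abs_add_le (a + b + c) e
    have h2 := abs_add_le (a + b) c
    have h3 := abs_add_le a b
    rcases le_total 1 |e| with he | he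
    · rw [min_eq_left he]
      linarith [min_le_left 1 |a + b + c + e|, abs_nonneg a, abs_nonneg b, abs_nonneg c]
    · rw [min_eq_right he]
      linarith [min_le_right 1 |a + b + c + e|]
  have h4 := pow_le_pow_left₀ (le_min zero_le_one (abs_nonneg _)) h 2
  rw [← sq_abs a, ← sq_abs b, ← sq_abs c]
  nlinarith [sq_nonneg (|a| - |b|), sq_nonneg (|a| - |c|), sq_nonneg (|a| - min 1 |e|),
    sq_nonneg (|b| - |c|), sq_nonneg (|b| - min 1 |e|), sq_nonneg (|c| - min 1 |e|)]

variable {w b g k : Fin d → ℝ} {p : ℝ → ℝ} {σ m : ℝ} {H : (Fin d → ℝ) → ℝ}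

lemma integral_min_one_abs_remainder_sq_le (hH : Measurable H) :
    ∫ ω, min 1 |(∑ i, b i * (arProposal g k ω i ^ 2 - ω.1 i ^ 2) + H ω.1 - H (arProposal g k ω))
        - (∑ i, 2 * b i * g i * k i * ω.1 i * ω.2 i - σ ^ 2 / 2)| ^ 2 ∂prodGaussian d
      ≤ 4 * ((∑ i, (b i * (g i ^ 2 - 1)) ^ 2) * gaussianSqVar
        + (∑ i, (b i * k i ^ 2) ^ 2) * gaussianSqVar
        + (∑ i, b i * (g i ^ 2 + k i ^ 2 - 1) + σ ^ 2 / 2) ^ 2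
        + ∫ ω, min 1 |H ω.1 - H (arProposal g k ω)| ^ 2 ∂prodGaussian d) := by
  let P (x : Fin d → ℝ) : ℝ := ∑ i, b i * (g i ^ 2 - 1) * (x i ^ 2 - 1)
  let R (x : Fin d → ℝ) : ℝ := ∑ i, b i * k i ^ 2 * (x i ^ 2 - 1)
  have hP : Integrable (fun ω : (Fin d → ℝ) × (Fin d → ℝ) => P ω.1 ^ 2) (prodGaussian d) :=
    ((memLp_sum_sq_sub_one fun i => b i * (g i ^ 2 - 1)).comp_fst
      (_root_.stdGaussian d)).integrable_sq
  have hR : Integrable (fun ω : (Fin d → ℝ) × (Fin d → ℝ) => R ω.2 ^ 2) (prodGaussian d) :=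
    ((memLp_sum_sq_sub_one fun i => b i * k i ^ 2).comp_snd (_root_.stdGaussian d)).integrable_sq
  have iP : ∫ ω, P ω.1 ^ 2 ∂prodGaussian d
      = (∑ i, (b i * (g i ^ 2 - 1)) ^ 2) * gaussianSqVar := by
    rw [prodGaussian, integral_fun_fst (f := fun x => P x ^ 2), ← integral_sq_sum_sq_sub_one]
    simp [P]
  have iR : ∫ ω, R ω.2 ^ 2 ∂prodGaussian d = (∑ i, (b i * k i ^ 2) ^ 2) * gaussianSqVar := by
    rw [prodGaussian, integral_fun_snd (f := fun x => R x ^ 2), ← integral_sq_sum_sq_sub_one]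
    simp [R]
  have hΔ : Integrable (fun ω => min 1 |H ω.1 - H (arProposal g k ω)| ^ 2) (prodGaussian d) :=
    Integrable.of_bound (by fun_prop) 1 (ae_of_all _ fun ω => by
      rw [Real.norm_eq_abs, abs_of_nonneg (sq_nonneg _)]; exact min_one_abs_sq_le_one _)
  have h2 : Integrable (fun ω : (Fin d → ℝ) × (Fin d → ℝ) => P ω.1 ^ 2 + R ω.2 ^ 2)
    (prodGaussian d) := hP.add hR
  have h3 : Integrable (fun ω : (Fin d → ℝ) × (Fin d → ℝ) => P ω.1 ^ 2 + R ω.2 ^ 2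
    + (∑ i, b i * (g i ^ 2 + k i ^ 2 - 1) + σ ^ 2 / 2) ^ 2) (prodGaussian d) :=
    h2.add (integrable_const _)
  rw [← iP, ← iR, ← integral_add hP hR]
  calc _ ≤ ∫ ω, 4 * (P ω.1 ^ 2 + R ω.2 ^ 2
          + (∑ i, b i * (g i ^ 2 + k i ^ 2 - 1) + σ ^ 2 / 2) ^ 2
          + min 1 |H ω.1 - H (arProposal g k ω)| ^ 2) ∂prodGaussian d := by
        refine integral_mono_of_nonneg (ae_of_all _ fun _ => sq_nonneg _)
          ((h3.add hΔ).const_mul _) (ae_of_all _ fun ω => ?_)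
        refine le_trans (le_of_eq ?_) (min_one_abs_add_sq_le _ _ _ _)
        simp only [sum_mul_arProposal_sq_sub, P, R]
        congr 3
        ring
    _ = _ := by
        rw [integral_const_mul, integral_add h3 hΔ, integral_add h2 (integrable_const _)]
        simp

lemma integrable_weighted_mhAccept {F : (Fin d → ℝ) × (Fin d → ℝ) → ℝ} (hF : Measurable F)
    {W : (Fin d → ℝ) × (Fin d → ℝ) → ℝ} (hW : Integrable W (prodGaussian d))
    (hH : Measurable H) (hm : ∀ x, m ≤ H x) :
    Integrable (fun ω => W ω * mhAccept (F ω) * Real.exp (-H ω.1)) (prodGaussian d) := by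
  refine (hW.mul_bdd (c := 1) ?_ (ae_of_all _ fun x => ?_)).mul_bdd (c := Real.exp (-m)) ?_
      (ae_of_all _ fun x => ?_)
  · exact (measurable_mhAccept.comp hF).aestronglyMeasurable
  · rw [Real.norm_eq_abs, abs_of_nonneg (mhAccept_nonneg _)]; exact mhAccept_le_one _
  · exact (hH.comp measurable_fst).neg.exp.aestronglyMeasurable
  · rw [Real.norm_eq_abs, abs_of_pos (Real.exp_pos _)]
    exact Real.exp_le_exp.mpr (neg_le_neg (hm _))

lemma memLp_comp_dot_snd (hw : w ⬝ᵥ w = 1) (hp : MemLp p 2 (gaussianReal 0 1)) :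
    MemLp (fun ω : (Fin d → ℝ) × (Fin d → ℝ) => p (w ⬝ᵥ ω.2)) 2 (prodGaussian d) :=
  (memLp_comp_dot hw hp).comp_snd (_root_.stdGaussian d)

/-- Replacing one log ratio by another under the equilibrium weight. -/
lemma abs_integral_mhAccept_sub_le (hw : w ⬝ᵥ w = 1) (hpm : Measurable p)
    (hp : MemLp p 2 (gaussianReal 0 1)) (hH : Measurable H) (hm : ∀ x, m ≤ H x)
    {F G : (Fin d → ℝ) × (Fin d → ℝ) → ℝ} (hF : Measurable F) (hG : Measurable G) :
    |∫ ω, p (w ⬝ᵥ ω.2) * mhAccept (F ω) * Real.exp (-H ω.1) ∂prodGaussian d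
      - ∫ ω, p (w ⬝ᵥ ω.2) * mhAccept (G ω) * Real.exp (-H ω.1) ∂prodGaussian d|
      ≤ Real.exp (-m) * (√(∫ u, p u ^ 2 ∂gaussianReal 0 1)
        * √(∫ ω, min 1 |F ω - G ω| ^ 2 ∂prodGaussian d)) := by
  have hL := memLp_comp_dot_snd hw hp
  have hLi := hL.integrable (by norm_num)
  have hmin : MemLp (fun ω => min 1 |F ω - G ω|) 2 (prodGaussian d) :=
    MemLp.of_bound (by fun_prop) 1 (ae_of_all _ fun ω => by
      rw [Real.norm_eq_abs, abs_of_nonneg (le_min zero_le_one (abs_nonneg _))]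
      exact min_le_left _ _)
  have hsq : ∫ ω, p (w ⬝ᵥ ω.2) ^ 2 ∂prodGaussian d = ∫ u, p u ^ 2 ∂gaussianReal 0 1 := by
    rw [prodGaussian, integral_fun_snd (f := fun x => p (w ⬝ᵥ x) ^ 2), integral_sq_comp_dot hw hpm]
    simp
  rw [← integral_sub (integrable_weighted_mhAccept hF hLi hH hm)
    (integrable_weighted_mhAccept hG hLi hH hm)]
  calc _ ≤ ∫ ω, Real.exp (-m) * (|p (w ⬝ᵥ ω.2)| * |(min 1 |F ω - G ω|)|) ∂prodGaussian d := by
        refine (abs_integral_le_integral_abs).trans (integral_mono_of_nonneg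
          (ae_of_all _ fun _ => abs_nonneg _)
          ((hL.abs.integrable_mul hmin.abs).const_mul _) (ae_of_all _ fun ω => ?_))
        simp only
        rw [← sub_mul, ← mul_sub, abs_mul, abs_mul, abs_of_pos (Real.exp_pos _), mul_comm]
        refine mul_le_mul (Real.exp_le_exp.mpr (neg_le_neg (hm _)))
          (mul_le_mul_of_nonneg_left ?_ (abs_nonneg _)) (by positivity) (Real.exp_pos _).le
        exact (abs_mhAccept_sub_le_min _ _).trans (le_abs_self _)
    _ ≤ _ := by
        rw [integral_const_mul]
        refine mul_le_mul_of_nonneg_left ?_ (Real.exp_pos _).le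
        have := integral_abs_mul_abs_le_sqrt hL hmin
        rwa [hsq] at this

end

/-! ### The generalized Langevin proposal in one coordinate -/

/-- Contraction factor of the proposal in an eigendirection with `h λ² = t`. -/
noncomputable def langevinMean (θ t : ℝ) : ℝ := (1 - (1 - θ) * t / 2) / (1 + θ * t / 2)

/-- Noise amplitude of the proposal in an eigendirection with `h λ² = t`. -/
noncomputable def langevinStd (θ t : ℝ) : ℝ := √t / (1 + θ * t / 2)

section
variable {θ t : ℝ} (hθ : θ ∈ Set.Icc (0 : ℝ) 1) (ht : 0 ≤ t)
include hθ ht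

lemma one_le_langevin_denom : 1 ≤ 1 + θ * t / 2 := by
  have := mul_nonneg hθ.1 ht
  linarith

omit hθ in
lemma langevinStd_sq : langevinStd θ t ^ 2 = t * (1 / (1 + θ * t / 2) ^ 2) := by
  rw [langevinStd, div_pow, Real.sq_sqrt ht]; ring

lemma one_div_denom_sq_le_one : 1 / (1 + θ * t / 2) ^ 2 ≤ 1 := by
  have := one_le_langevin_denom hθ ht
  exact (div_le_one (by positivity)).mpr (one_le_pow₀ this)

lemma one_sub_le_one_div_denom_sq : 1 - t ≤ 1 / (1 + θ * t / 2) ^ 2 := by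
  have h := one_le_langevin_denom hθ ht
  rw [le_div_iff₀ (by positivity)]
  have hx : 0 ≤ θ * t := mul_nonneg hθ.1 ht
  have hxt : θ * t ≤ t := mul_le_of_le_one_left ht hθ.2
  have : (1 - θ * t) * (1 + θ * t / 2) ^ 2 ≤ 1 := by
    nlinarith [pow_nonneg hx 3, pow_nonneg hx 2]
  nlinarith [sq_nonneg (1 + θ * t / 2)]

lemma langevinStd_sq_le : langevinStd θ t ^ 2 ≤ t := by
  rw [langevinStd_sq ht]
  exact mul_le_of_le_one_right ht (one_div_denom_sq_le_one hθ ht)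

lemma langevinMean_sq_add_langevinStd_sq : langevinMean θ t ^ 2 + langevinStd θ t ^ 2 - 1
    = (1 - 2 * θ) / 4 * t ^ 2 * (1 / (1 + θ * t / 2) ^ 2) := by
  have h := one_le_langevin_denom hθ ht
  rw [langevinStd_sq ht, langevinMean]
  have : 2 + θ * t ≠ 0 := by linarith [mul_nonneg hθ.1 ht]
  field_simp
  ring

lemma one_sub_langevinMean : 1 - langevinMean θ t = t / 2 / (1 + θ * t / 2) := by
  have h := one_le_langevin_denom hθ ht
  have : 2 + θ * t ≠ 0 := by linarith [mul_nonneg hθ.1 ht]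
  rw [langevinMean]
  field_simp
  ring

lemma one_sub_langevinMean_nonneg : 0 ≤ 1 - langevinMean θ t := by
  have h := one_le_langevin_denom hθ ht
  rw [one_sub_langevinMean hθ ht]
  positivity

lemma one_sub_langevinMean_le : 1 - langevinMean θ t ≤ t / 2 := by
  rw [one_sub_langevinMean hθ ht]
  exact div_le_self (by positivity) (one_le_langevin_denom hθ ht)

variable (ht1 : t ≤ 1)
include ht1

lemma langevinMean_nonneg : 0 ≤ langevinMean θ t := by
  linarith [one_sub_langevinMean_le hθ ht]

lemma langevinMean_sq_le_one : langevinMean θ t ^ 2 ≤ 1 :=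
  pow_le_one₀ (langevinMean_nonneg hθ ht ht1) (by linarith [one_sub_langevinMean_nonneg hθ ht])

omit ht1 in
lemma one_sub_le_langevinMean_sq : 1 - t ≤ langevinMean θ t ^ 2 := by
  nlinarith [one_sub_langevinMean_le hθ ht, sq_nonneg (1 - langevinMean θ t)]

lemma langevin_increment_sq_le : (1 - langevinMean θ t) ^ 2 + langevinStd θ t ^ 2 ≤ 2 * t := by
  nlinarith [one_sub_langevinMean_le hθ ht, one_sub_langevinMean_nonneg hθ ht,
    langevinStd_sq_le hθ ht]

omit hθ ht1 in
lemma langevin_leading_sq :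
    (2 * ((θ - 1 / 2) / 4 * t) * langevinMean θ t * langevinStd θ t) ^ 2
      = (θ - 1 / 2) ^ 2 / 4 * t ^ 3 * (langevinMean θ t ^ 2 * (1 / (1 + θ * t / 2) ^ 2)) := by
  rw [mul_pow, langevinStd_sq ht]; ring

lemma one_sub_le_langevinMean_sq_mul :
    1 - 2 * t ≤ langevinMean θ t ^ 2 * (1 / (1 + θ * t / 2) ^ 2) := by
  have h1 := one_sub_le_langevinMean_sq hθ ht
  have h2 := one_sub_le_one_div_denom_sq hθ ht
  nlinarith [mul_le_mul h1 h2 (by linarith) (sq_nonneg _)]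

lemma langevinMean_sq_mul_le_one :
    langevinMean θ t ^ 2 * (1 / (1 + θ * t / 2) ^ 2) ≤ 1 :=
  mul_le_one₀ (langevinMean_sq_le_one hθ ht ht1) (by positivity) (one_div_denom_sq_le_one hθ ht)

omit ht ht1 in
lemma sq_sub_half_le : (θ - 1 / 2) ^ 2 ≤ 1 / 4 := by
  nlinarith [hθ.1, hθ.2]

lemma langevin_leading_sq_le :
    (2 * ((θ - 1 / 2) / 4 * t) * langevinMean θ t * langevinStd θ t) ^ 2 ≤ t ^ 3 := by
  rw [langevin_leading_sq ht]
  have h1 := langevinMean_sq_mul_le_one hθ ht ht1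
  have h3 : (θ - 1 / 2) ^ 2 / 4 * t ^ 3 ≤ t ^ 3 :=
    mul_le_of_le_one_left (by positivity) (by linarith [sq_sub_half_le hθ])
  exact (mul_le_of_le_one_right (by positivity) h1).trans h3

lemma langevin_fluct_mean_sq_le :
    ((θ - 1 / 2) / 4 * t * (langevinMean θ t ^ 2 - 1)) ^ 2 ≤ t ^ 4 := by
  have h1 := langevinMean_sq_le_one hθ ht ht1
  have h2 := one_sub_le_langevinMean_sq hθ ht
  have h3 : (langevinMean θ t ^ 2 - 1) ^ 2 ≤ t ^ 2 := by nlinarith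
  have h4 := sq_sub_half_le hθ
  calc _ = (θ - 1 / 2) ^ 2 / 16 * (t ^ 2 * (langevinMean θ t ^ 2 - 1) ^ 2) := by ring
    _ ≤ 1 * (t ^ 2 * t ^ 2) := by gcongr; linarith
    _ = _ := by ring

omit ht1 in
lemma langevin_fluct_std_sq_le :
    ((θ - 1 / 2) / 4 * t * langevinStd θ t ^ 2) ^ 2 ≤ t ^ 4 := by
  have h3 := langevinStd_sq_le hθ ht
  have h4 := sq_sub_half_le hθ
  calc _ = (θ - 1 / 2) ^ 2 / 16 * (t ^ 2 * (langevinStd θ t ^ 2) ^ 2) := by ring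
    _ ≤ 1 * (t ^ 2 * t ^ 2) := by gcongr; linarith
    _ = _ := by ring

end

section
variable {d : ℕ} {θ ε T : ℝ} {t : Fin d → ℝ} (hθ : θ ∈ Set.Icc (0 : ℝ) 1)
  (ht : ∀ i, 0 ≤ t i) (htε : ∀ i, t i ≤ ε) (hε1 : ε ≤ 1)
include hθ ht htε hε1

lemma abs_sum_langevin_leading_sq_sub_le :
    |∑ i, (2 * ((θ - 1 / 2) / 4 * t i) * langevinMean θ (t i) * langevinStd θ (t i)) ^ 2
      - (θ - 1 / 2) ^ 2 / 4 * T| ≤ 2 * ε * ∑ i, t i ^ 3 + |∑ i, t i ^ 3 - T| := by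
  have h4 : (θ - 1 / 2) ^ 2 / 4 ≤ 1 := by nlinarith [hθ.1, hθ.2]
  have h40 : 0 ≤ (θ - 1 / 2) ^ 2 / 4 := by positivity
  have key : |∑ i, ((θ - 1 / 2) ^ 2 / 4 * t i ^ 3 * (langevinMean θ (t i) ^ 2
      * (1 / (1 + θ * t i / 2) ^ 2)) - (θ - 1 / 2) ^ 2 / 4 * t i ^ 3)|
      ≤ 2 * ε * ∑ i, t i ^ 3 := by
    rw [Finset.mul_sum]
    refine (Finset.abs_sum_le_sum_abs _ _).trans (Finset.sum_le_sum fun i _ => ?_)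
    have h1 := one_sub_le_langevinMean_sq_mul hθ (ht i) ((htε i).trans hε1)
    have h2 := langevinMean_sq_mul_le_one hθ (ht i) ((htε i).trans hε1)
    have h3 : 0 ≤ t i ^ 3 := pow_nonneg (ht i) 3
    rw [← mul_sub_one, abs_mul, abs_of_nonneg (mul_nonneg h40 h3), mul_comm]
    refine mul_le_mul ?_ (mul_le_of_le_one_left h3 h4) (by positivity) (by linarith [ht i, htε i])
    rw [abs_le]
    constructor <;> linarith [htε i, ht i]
  rw [Finset.sum_sub_distrib, ← Finset.mul_sum] at key
  simp only [fun i => langevin_leading_sq (θ := θ) (ht i)]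
  have h5 : |(θ - 1 / 2) ^ 2 / 4 * ∑ i, t i ^ 3 - (θ - 1 / 2) ^ 2 / 4 * T|
      ≤ |∑ i, t i ^ 3 - T| := by
    rw [← mul_sub, abs_mul, abs_of_nonneg h40]
    exact mul_le_of_le_one_left (abs_nonneg _) h4
  exact (abs_sub_le _ _ _).trans (add_le_add key h5)

omit hε1 in
lemma abs_sum_langevin_mean_add_le :
    |∑ i, (θ - 1 / 2) / 4 * t i * (langevinMean θ (t i) ^ 2 + langevinStd θ (t i) ^ 2 - 1)
      + (θ - 1 / 2) ^ 2 / 8 * T| ≤ ε * ∑ i, t i ^ 3 + |∑ i, t i ^ 3 - T| := by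
  have h4 : (θ - 1 / 2) ^ 2 / 8 ≤ 1 := by nlinarith [hθ.1, hθ.2]
  have h40 : 0 ≤ (θ - 1 / 2) ^ 2 / 8 := by positivity
  have key : |∑ i, ((θ - 1 / 2) / 4 * t i * (langevinMean θ (t i) ^ 2 + langevinStd θ (t i) ^ 2 - 1)
      + (θ - 1 / 2) ^ 2 / 8 * t i ^ 3)| ≤ ε * ∑ i, t i ^ 3 := by
    rw [Finset.mul_sum]
    refine (Finset.abs_sum_le_sum_abs _ _).trans (Finset.sum_le_sum fun i _ => ?_)
    have h1 := one_sub_le_one_div_denom_sq hθ (ht i)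
    have h2 := one_div_denom_sq_le_one hθ (ht i)
    have h3 : 0 ≤ t i ^ 3 := pow_nonneg (ht i) 3
    rw [langevinMean_sq_add_langevinStd_sq hθ (ht i)]
    have e : (θ - 1 / 2) / 4 * t i * ((1 - 2 * θ) / 4 * t i ^ 2 * (1 / (1 + θ * t i / 2) ^ 2))
        + (θ - 1 / 2) ^ 2 / 8 * t i ^ 3
        = (1 - 1 / (1 + θ * t i / 2) ^ 2) * ((θ - 1 / 2) ^ 2 / 8 * t i ^ 3) := by ring
    rw [e, abs_mul, abs_of_nonneg (mul_nonneg h40 h3)]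
    refine mul_le_mul ?_ (mul_le_of_le_one_left h3 h4) (by positivity) (by linarith [ht i, htε i])
    rw [abs_le]
    constructor <;> linarith [htε i, ht i]
  rw [Finset.sum_add_distrib, ← Finset.mul_sum] at key
  have h5 : |(θ - 1 / 2) ^ 2 / 8 * T - (θ - 1 / 2) ^ 2 / 8 * ∑ i, t i ^ 3|
      ≤ |∑ i, t i ^ 3 - T| := by
    rw [← mul_sub, abs_mul, abs_of_nonneg h40, abs_sub_comm]
    exact mul_le_of_le_one_left (abs_nonneg _) h4
  calc _ = |(∑ i, (θ - 1 / 2) / 4 * t i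
        * (langevinMean θ (t i) ^ 2 + langevinStd θ (t i) ^ 2 - 1)
        + (θ - 1 / 2) ^ 2 / 8 * ∑ i, t i ^ 3) + ((θ - 1 / 2) ^ 2 / 8 * T
        - (θ - 1 / 2) ^ 2 / 8 * ∑ i, t i ^ 3)| := by congr 1; ring
    _ ≤ _ := (abs_add_le _ _).trans (add_le_add key h5)

omit hθ hε1 in
lemma sum_pow_four_le : ∑ i, t i ^ 4 ≤ ε * ∑ i, t i ^ 3 := by
  rw [Finset.mul_sum]
  refine Finset.sum_le_sum fun i _ => ?_
  rw [pow_succ' (t i) 3]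
  exact mul_le_mul_of_nonneg_right (htε i) (pow_nonneg (ht i) 3)

/-- Nonasymptotic bound on the distance between the (weighted) equilibrium acceptance rate and its
limit. -/
lemma abs_integral_langevin_mhAccept_sub_le {w : Fin d → ℝ} {p : ℝ → ℝ} {m : ℝ}
    {H : (Fin d → ℝ) → ℝ} (hε : 0 ≤ ε) (hT : 0 ≤ T)
    (hw : w ⬝ᵥ w = 1) (hpm : Measurable p) (hp : MemLp p 2 (gaussianReal 0 1))
    (h1 : ∫ u, p u ∂gaussianReal 0 1 = 1) (hH : Measurable H) (hm : ∀ x, m ≤ H x)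
    (hH1 : ∫ x, Real.exp (-H x) ∂_root_.stdGaussian d = 1) :
    let Y := arProposal (fun i => langevinMean θ (t i)) (fun i => langevinStd θ (t i))
    |∫ ω, p (w ⬝ᵥ ω.2) * mhAccept (∑ i, (θ - 1 / 2) / 4 * t i * (Y ω i ^ 2 - ω.1 i ^ 2)
        + H ω.1 - H (Y ω)) * Real.exp (-H ω.1) ∂prodGaussian d
      - 2 * Phi (-(|θ - 1 / 2| * √T / 4))|
      ≤ Real.exp (-m) * (√(∫ u, p u ^ 2 ∂gaussianReal 0 1)
          * √(4 * (ε * ∑ i, t i ^ 3 * gaussianSqVar + ε * ∑ i, t i ^ 3 * gaussianSqVar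
            + (ε * ∑ i, t i ^ 3 + |∑ i, t i ^ 3 - T|) ^ 2
            + ∫ ω, min 1 |H ω.1 - H (Y ω)| ^ 2 ∂prodGaussian d)))
        + Real.exp (-m) * (√(∫ u, p u ^ 2 ∂gaussianReal 0 1) * ε
          + √(√(ε ^ 2 * (∑ i, t i ^ 3) * gaussianSqVar)
            + (2 * ε * ∑ i, t i ^ 3 + |∑ i, t i ^ 3 - T|) + ε ^ 2)) := by
  intro Y
  set g : Fin d → ℝ := fun i => langevinMean θ (t i) with hg
  set k : Fin d → ℝ := fun i => langevinStd θ (t i) with hk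
  set b : Fin d → ℝ := fun i => (θ - 1 / 2) / 4 * t i with hb
  set σ : ℝ := |θ - 1 / 2| * √T / 2 with hσ
  have hσ0 : 0 ≤ σ := by positivity
  have hσ2 : σ ^ 2 = (θ - 1 / 2) ^ 2 / 4 * T := by
    rw [hσ, div_pow, mul_pow, sq_abs, Real.sq_sqrt hT]; ring
  have ht1 (i) : t i ≤ 1 := (htε i).trans hε1
  have hS3 : 0 ≤ ∑ i, t i ^ 3 := Finset.sum_nonneg fun i _ => pow_nonneg (ht i) 3
  have hvar := gaussianSqVar_nonneg
  have hsum4 := sum_pow_four_le ht htε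
  have ha (i) : |2 * b i * g i * k i| ≤ ε := by
    refine abs_le_of_sq_le_sq ?_ hε
    refine (langevin_leading_sq_le hθ (ht i) (ht1 i)).trans ?_
    calc t i ^ 3 ≤ t i ^ 2 := pow_le_pow_of_le_one (ht i) (ht1 i) (by norm_num)
      _ ≤ ε ^ 2 := pow_le_pow_left₀ (ht i) (htε i) 2
  have hrem := integral_min_one_abs_remainder_sq_le (b := b) (g := g) (k := k) (σ := σ) hH
  have hcore := abs_integral_prod_mhAccept_sub_le hw hpm hp h1 hσ0 hε ha hH hm hH1
  have hsub := abs_integral_mhAccept_sub_le hw hpm hp hH hm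
    (F := fun ω => ∑ i, b i * (Y ω i ^ 2 - ω.1 i ^ 2) + H ω.1 - H (Y ω))
    (G := fun ω => ∑ i, 2 * b i * g i * k i * ω.1 i * ω.2 i - σ ^ 2 / 2)
    (by fun_prop) (by fun_prop)
  have hPhi : |θ - 1 / 2| * √T / 4 = σ / 2 := by rw [hσ]; ring
  rw [hPhi]
  refine (abs_sub_le _ _ _).trans (add_le_add (hsub.trans ?_) (hcore.trans ?_))
  · gcongr
    refine hrem.trans ?_
    have e1 : ∑ i, (b i * (g i ^ 2 - 1)) ^ 2 ≤ ε * ∑ i, t i ^ 3 :=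
      (Finset.sum_le_sum fun i _ => langevin_fluct_mean_sq_le hθ (ht i) (ht1 i)).trans hsum4
    have e2 : ∑ i, (b i * k i ^ 2) ^ 2 ≤ ε * ∑ i, t i ^ 3 :=
      (Finset.sum_le_sum fun i _ => langevin_fluct_std_sq_le hθ (ht i)).trans hsum4
    have e3 : (∑ i, b i * (g i ^ 2 + k i ^ 2 - 1) + σ ^ 2 / 2) ^ 2
        ≤ (ε * ∑ i, t i ^ 3 + |∑ i, t i ^ 3 - T|) ^ 2 := by
      rw [← sq_abs]
      refine pow_le_pow_left₀ (abs_nonneg _) ?_ 2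
      have := abs_sum_langevin_mean_add_le (T := T) hθ ht htε
      rwa [show (θ - 1 / 2) ^ 2 / 8 * T = σ ^ 2 / 2 by rw [hσ2]; ring] at this
    rw [← Finset.sum_mul, ← mul_assoc]
    gcongr
  · have e1 : ∑ i, (2 * b i * g i * k i) ^ 2 ≤ ∑ i, t i ^ 3 :=
      Finset.sum_le_sum fun i _ => langevin_leading_sq_le hθ (ht i) (ht1 i)
    have e2 : |∑ i, (2 * b i * g i * k i) ^ 2 - σ ^ 2|
        ≤ 2 * ε * ∑ i, t i ^ 3 + |∑ i, t i ^ 3 - T| := by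
      rw [hσ2]; exact abs_sum_langevin_leading_sq_sub_le hθ ht htε hε1
    gcongr

end

/-! ### Optimal scaling in diagonal coordinates -/

/-- Deviation of the squared normalized increment along an eigendirection from its leading term. -/
lemma abs_sq_langevin_increment_sub_le {θ s : ℝ} (hθ : θ ∈ Set.Icc (0 : ℝ) 1) (hs : 0 < s)
    (hs1 : s ≤ 1) (x y : ℝ) :
    |((langevinMean θ s - 1) * x + langevinStd θ s * y) ^ 2 / s - y ^ 2|
      ≤ 4 * √s * (x ^ 2 + y ^ 2) := by
  have h1 := one_sub_le_one_div_denom_sq hθ hs.le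
  have h2 := one_div_denom_sq_le_one hθ hs.le
  have hD := one_le_langevin_denom hθ hs.le
  have hg := one_sub_langevinMean hθ hs.le
  obtain ⟨r, hr, rfl⟩ : ∃ r : ℝ, 0 < r ∧ s = r ^ 2 :=
    ⟨√s, Real.sqrt_pos.mpr hs, (Real.sq_sqrt hs.le).symm⟩
  have hr1 : r ≤ 1 := (sq_le_one_iff₀ hr.le).mp hs1
  have e : ((langevinMean θ (r ^ 2) - 1) * x + langevinStd θ (r ^ 2) * y) ^ 2 / r ^ 2
      = 1 / (1 + θ * r ^ 2 / 2) ^ 2 * (y - r / 2 * x) ^ 2 := by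
    rw [← neg_sub, hg, langevinStd, Real.sqrt_sq hr.le]
    have : 1 + θ * r ^ 2 / 2 ≠ 0 := by linarith
    generalize 1 + θ * r ^ 2 / 2 = D at this
    field_simp
    ring
  rw [e, Real.sqrt_sq hr.le]
  generalize 1 / (1 + θ * r ^ 2 / 2) ^ 2 = q at h1 h2
  have hr2 : r ^ 2 ≤ r := by nlinarith
  have hsq := sq_nonneg (y - r / 2 * x)
  have hxy : |x * y| ≤ (x ^ 2 + y ^ 2) / 2 := by
    rw [abs_le]; constructor <;> nlinarith [sq_nonneg (x - y), sq_nonneg (x + y)]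
  have hrxy : |r * (x * y)| ≤ r * ((x ^ 2 + y ^ 2) / 2) := by
    rw [abs_mul, abs_of_pos hr]; exact mul_le_mul_of_nonneg_left hxy hr.le
  rw [abs_le] at hrxy ⊢
  have hx : r ^ 2 * x ^ 2 ≤ r * x ^ 2 := mul_le_mul_of_nonneg_right hr2 (sq_nonneg x)
  have hy : 0 ≤ r * y ^ 2 := by positivity
  constructor
  · have h3 : (y - r / 2 * x) ^ 2 ≤ 2 * y ^ 2 + x ^ 2 := by
      nlinarith [sq_nonneg (y + r / 2 * x), mul_le_mul_of_nonneg_right hr2 (sq_nonneg x),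
        mul_le_mul_of_nonneg_right hr1 (sq_nonneg x)]
    have h4 : r ^ 2 * (y - r / 2 * x) ^ 2 ≤ r * (2 * y ^ 2 + x ^ 2) :=
      mul_le_mul hr2 h3 hsq hr.le
    have h5 : (1 - r ^ 2) * (y - r / 2 * x) ^ 2 ≤ q * (y - r / 2 * x) ^ 2 :=
      mul_le_mul_of_nonneg_right h1 hsq
    nlinarith [hrxy.1, hrxy.2, sq_nonneg (r * x), mul_nonneg hr.le (sq_nonneg x)]
  · have h5 : q * (y - r / 2 * x) ^ 2 ≤ 1 * (y - r / 2 * x) ^ 2 :=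
      mul_le_mul_of_nonneg_right h2 hsq
    nlinarith [hrxy.1, hrxy.2, mul_nonneg hr.le (sq_nonneg x)]

section
variable {θ T m : ℝ} {t w : ∀ d : ℕ, Fin d → ℝ} {ε : ℕ → ℝ} {H : ∀ d : ℕ, (Fin d → ℝ) → ℝ}

/-- The generalized Langevin proposal in coordinates where `h V A` is diagonal with entries `t`. -/
noncomputable abbrev langevinProposal {d : ℕ} (θ : ℝ) (t : Fin d → ℝ) :
    (Fin d → ℝ) × (Fin d → ℝ) → Fin d → ℝ :=
  arProposal (fun i => langevinMean θ (t i)) (fun i => langevinStd θ (t i))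

/-- The log acceptance ratio in coordinates where `h V A` is diagonal with entries `t`. -/
noncomputable def langevinLogRatio {d : ℕ} (θ : ℝ) (t : Fin d → ℝ) (H : (Fin d → ℝ) → ℝ)
    (ω : (Fin d → ℝ) × (Fin d → ℝ)) : ℝ :=
  ∑ i, (θ - 1 / 2) / 4 * t i * (langevinProposal θ t ω i ^ 2 - ω.1 i ^ 2)
    + H ω.1 - H (langevinProposal θ t ω)

lemma measurable_langevinLogRatio {d : ℕ} (t : Fin d → ℝ) {H : (Fin d → ℝ) → ℝ}
    (hH : Measurable H) : Measurable (langevinLogRatio θ t H) := by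
  unfold langevinLogRatio; fun_prop

lemma dot_langevinProposal_sub {d : ℕ} {t w : Fin d → ℝ} {s : ℝ} (hws : ∀ i, w i ≠ 0 → t i = s)
    (ω : (Fin d → ℝ) × (Fin d → ℝ)) :
    w ⬝ᵥ (langevinProposal θ t ω - ω.1)
      = (langevinMean θ s - 1) * (w ⬝ᵥ ω.1) + langevinStd θ s * (w ⬝ᵥ ω.2) := by
  simp only [dotProduct, Finset.mul_sum, ← Finset.sum_add_distrib]
  refine Finset.sum_congr rfl fun i _ => ?_
  by_cases h : w i = 0
  · simp [h]
  · simp only [langevinProposal, arProposal, Pi.sub_apply, hws i h]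
    ring

lemma abs_integral_langevin_increment_sub_le {d : ℕ} {t w : Fin d → ℝ} {s : ℝ}
    {H : (Fin d → ℝ) → ℝ} {F : (Fin d → ℝ) × (Fin d → ℝ) → ℝ} (hθ : θ ∈ Set.Icc (0 : ℝ) 1)
    (hs : 0 < s) (hs1 : s ≤ 1) (hw : w ⬝ᵥ w = 1) (hws : ∀ i, w i ≠ 0 → t i = s)
    (hF : Measurable F) (hH : Measurable H) (hm : ∀ x, m ≤ H x) :
    |∫ ω, (w ⬝ᵥ (langevinProposal θ t ω - ω.1)) ^ 2 / s * mhAccept (F ω) * Real.exp (-H ω.1)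
        ∂prodGaussian d
      - ∫ ω, (w ⬝ᵥ ω.2) ^ 2 * mhAccept (F ω) * Real.exp (-H ω.1) ∂prodGaussian d|
      ≤ 4 * √s * (1 + 1) * Real.exp (-m) := by
  have h1 : MemLp (fun ω : (Fin d → ℝ) × (Fin d → ℝ) => w ⬝ᵥ ω.1) 2 (prodGaussian d) :=
    (memLp_dot w).comp_fst (_root_.stdGaussian d)
  have h2 : MemLp (fun ω : (Fin d → ℝ) × (Fin d → ℝ) => w ⬝ᵥ ω.2) 2 (prodGaussian d) :=
    (memLp_dot w).comp_snd (_root_.stdGaussian d)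
  have hunit : ∫ x, (w ⬝ᵥ x) ^ 2 ∂_root_.stdGaussian d = 1 := by
    rw [integral_sq_comp_dot hw (p := fun u => u) (by fun_prop), integral_sq_gaussian]
  have i1 : ∫ ω, (w ⬝ᵥ ω.1) ^ 2 ∂prodGaussian d = 1 := by
    rw [prodGaussian, integral_fun_fst (f := fun x : Fin d → ℝ => (w ⬝ᵥ x) ^ 2), hunit]; simp
  have i2 : ∫ ω, (w ⬝ᵥ ω.2) ^ 2 ∂prodGaussian d = 1 := by
    rw [prodGaussian, integral_fun_snd (f := fun x : Fin d → ℝ => (w ⬝ᵥ x) ^ 2), hunit]; simp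
  simp only [dot_langevinProposal_sub hws]
  have hinc : Integrable (fun ω : (Fin d → ℝ) × (Fin d → ℝ) => ((langevinMean θ s - 1) * (w ⬝ᵥ ω.1)
      + langevinStd θ s * (w ⬝ᵥ ω.2)) ^ 2 / s) (prodGaussian d) :=
    ((h1.const_mul (langevinMean θ s - 1)).add
      (h2.const_mul (langevinStd θ s))).integrable_sq.div_const s
  have hsum : Integrable (fun ω : (Fin d → ℝ) × (Fin d → ℝ) => (w ⬝ᵥ ω.1) ^ 2 + (w ⬝ᵥ ω.2) ^ 2)
    (prodGaussian d) := h1.integrable_sq.add h2.integrable_sq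
  rw [← integral_sub (integrable_weighted_mhAccept hF hinc hH hm)
    (integrable_weighted_mhAccept hF h2.integrable_sq hH hm)]
  calc _ ≤ ∫ ω : (Fin d → ℝ) × (Fin d → ℝ), 4 * √s * ((w ⬝ᵥ ω.1) ^ 2 + (w ⬝ᵥ ω.2) ^ 2)
          * Real.exp (-m) ∂prodGaussian d := by
        refine abs_integral_le_integral_abs.trans (integral_mono_of_nonneg
          (ae_of_all _ fun _ => abs_nonneg _) ((hsum.const_mul _).mul_const _)
          (ae_of_all _ fun ω => ?_))
        simp only
        rw [← sub_mul, ← sub_mul, abs_mul, abs_mul, abs_of_pos (Real.exp_pos _),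
          abs_of_nonneg (mhAccept_nonneg _)]
        refine mul_le_mul ?_ (Real.exp_le_exp.mpr (neg_le_neg (hm _))) (Real.exp_pos _).le
          (by positivity)
        exact (mul_le_of_le_one_right (abs_nonneg _) (mhAccept_le_one _)).trans
          (abs_sq_langevin_increment_sub_le hθ hs hs1 _ _)
    _ = _ := by
        rw [integral_mul_const, integral_const_mul,
          integral_add h1.integrable_sq h2.integrable_sq, i1, i2]

variable (hθ : θ ∈ Set.Icc (0 : ℝ) 1) (hε : Tendsto ε atTop (𝓝 0)) (hε0 : ∀ d, 0 ≤ ε d)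
  (ht : ∀ d i, 0 ≤ t d i) (htε : ∀ d i, t d i ≤ ε d)
include hθ hε ht htε

lemma tendsto_integral_min_one_abs_sub_sq {u u' : ∀ d : ℕ, Fin d → ℝ} {U : ℝ} {δ : ℝ → ℝ → ℝ}
    (hu : ∀ d i, 0 ≤ u d i) (hu' : ∀ d i, 0 ≤ u' d i)
    (hU : ∀ᶠ d in atTop, ∑ i, u d i ≤ U)
    (hu't : Tendsto (fun d => ∑ i, u' d i * t d i) atTop (𝓝 0))
    (hδ : ∀ K : ℝ, ∃ D, ∀ a b, |a| ≤ K → |b| ≤ K → δ a b ≤ D)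
    (hlip : ∀ᶠ d in atTop, ∀ x y, |H d x - H d y|
      ≤ δ (√(∑ i, u d i * x i ^ 2)) (√(∑ i, u d i * y i ^ 2))
        * √(∑ i, u' d i * (x i - y i) ^ 2)) :
    Tendsto (fun d => ∫ ω, min 1 |H d ω.1 - H d (langevinProposal θ (t d) ω)| ^ 2 ∂prodGaussian d)
      atTop (𝓝 0) := by
  rw [Metric.tendsto_nhds]
  intro e he
  obtain ⟨K, hK1, hKe⟩ : ∃ K : ℝ, 1 ≤ K ∧ 3 * |U| / K ^ 2 < e / 2 := by
    have h : Tendsto (fun K : ℝ => 3 * |U| / K ^ 2) atTop (𝓝 0) :=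
      tendsto_const_nhds.div_atTop (tendsto_pow_atTop two_ne_zero)
    exact ((eventually_ge_atTop 1).and (h.eventually_lt_const (half_pos he))).exists
  obtain ⟨D, hD⟩ := hδ K
  have hlim : Tendsto (fun d => D ^ 2 * (2 * ∑ i, u' d i * t d i)) atTop (𝓝 0) := by
    simpa using (hu't.const_mul 2).const_mul (D ^ 2)
  filter_upwards [hlim.eventually_lt_const (half_pos he), hlip, hU,
    hε.eventually_le_const one_pos] with d h1 h2 h3 h4
  rw [dist_zero_right, Real.norm_eq_abs, abs_of_nonneg (integral_nonneg fun _ => sq_nonneg _)]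
  refine (integral_min_one_abs_sub_sq_le (hu d) (hu' d) (by linarith) hD h2).trans_lt ?_
  have ht1 (i) : t d i ≤ 1 := (htε d i).trans h4
  have hA : ∑ i, u d i + ∑ i, u d i * (langevinMean θ (t d i) ^ 2 + langevinStd θ (t d i) ^ 2)
      ≤ 3 * |U| := by
    have : ∑ i, u d i * (langevinMean θ (t d i) ^ 2 + langevinStd θ (t d i) ^ 2)
        ≤ ∑ i, u d i * 2 := by
      refine Finset.sum_le_sum fun i _ => mul_le_mul_of_nonneg_left ?_ (hu d i)
      linarith [langevinMean_sq_le_one hθ (ht d i) (ht1 i), langevinStd_sq_le hθ (ht d i), ht1 i]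
    rw [← Finset.sum_mul] at this
    linarith [le_abs_self U]
  have hB : ∑ i, u' d i * ((1 - langevinMean θ (t d i)) ^ 2 + langevinStd θ (t d i) ^ 2)
      ≤ 2 * ∑ i, u' d i * t d i := by
    rw [Finset.mul_sum]
    refine Finset.sum_le_sum fun i _ => ?_
    have := mul_le_mul_of_nonneg_left (langevin_increment_sq_le hθ (ht d i) (ht1 i)) (hu' d i)
    linarith
  calc _ ≤ 3 * |U| / K ^ 2 + D ^ 2 * (2 * ∑ i, u' d i * t d i) := by gcongr
    _ < e := by linarith

variable (hT : Tendsto (fun d => ∑ i, t d i ^ 3) atTop (𝓝 T))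
  (hH : ∀ d, Measurable (H d)) (hH1 : ∀ d, ∫ x, Real.exp (-H d x) ∂_root_.stdGaussian d = 1)
  (hm : ∀ᶠ d in atTop, ∀ x, m ≤ H d x)
  (hΔ : Tendsto (fun d => ∫ ω, min 1 |H d ω.1 - H d (langevinProposal θ (t d) ω)| ^ 2
    ∂prodGaussian d) atTop (𝓝 0))
  (hw : ∀ᶠ d in atTop, w d ⬝ᵥ w d = 1)
include hε0 hT hH hH1 hm hΔ hw

lemma tendsto_integral_langevin_mhAccept {p : ℝ → ℝ} (hpm : Measurable p)
    (hp : MemLp p 2 (gaussianReal 0 1)) (h1 : ∫ u, p u ∂gaussianReal 0 1 = 1) :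
    Tendsto (fun d => ∫ ω, p (w d ⬝ᵥ ω.2) * mhAccept (langevinLogRatio θ (t d) (H d) ω)
        * Real.exp (-H d ω.1) ∂prodGaussian d)
      atTop (𝓝 (2 * Phi (-(|θ - 1 / 2| * √T / 4)))) := by
  have hT0 : 0 ≤ T := ge_of_tendsto' hT fun d => Finset.sum_nonneg fun i _ => pow_nonneg (ht d i) 3
  have hT' : Tendsto (fun d => |∑ i, t d i ^ 3 - T|) atTop (𝓝 0) := by
    simpa using (hT.sub_const T).abs
  have hεT : Tendsto (fun d => ε d * ∑ i, t d i ^ 3) atTop (𝓝 0) := by simpa using hε.mul hT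
  have hbound : Tendsto (fun d => Real.exp (-m) * (√(∫ u, p u ^ 2 ∂gaussianReal 0 1)
          * √(4 * (ε d * ∑ i, t d i ^ 3 * gaussianSqVar + ε d * ∑ i, t d i ^ 3 * gaussianSqVar
            + (ε d * ∑ i, t d i ^ 3 + |∑ i, t d i ^ 3 - T|) ^ 2
            + ∫ ω, min 1 |H d ω.1 - H d (langevinProposal θ (t d) ω)| ^ 2 ∂prodGaussian d)))
        + Real.exp (-m) * (√(∫ u, p u ^ 2 ∂gaussianReal 0 1) * ε d
          + √(√(ε d ^ 2 * (∑ i, t d i ^ 3) * gaussianSqVar)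
            + (2 * ε d * ∑ i, t d i ^ 3 + |∑ i, t d i ^ 3 - T|) + ε d ^ 2))) atTop (𝓝 0) := by
    have a1 : Tendsto (fun d => ε d * ∑ i, t d i ^ 3 * gaussianSqVar) atTop (𝓝 0) := by
      simpa only [← Finset.sum_mul, ← mul_assoc, zero_mul] using hεT.mul_const gaussianSqVar
    have a2 := ((((a1.add a1).add ((hεT.add hT').pow 2)).add hΔ).const_mul 4).sqrt
    have a3 : Tendsto (fun d => ε d ^ 2 * (∑ i, t d i ^ 3) * gaussianSqVar) atTop (𝓝 0) := by
      simpa using ((hε.pow 2).mul hT).mul_const gaussianSqVar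
    have a4 : Tendsto (fun d => 2 * ε d * ∑ i, t d i ^ 3) atTop (𝓝 0) := by
      simpa only [← mul_assoc, mul_zero] using hεT.const_mul 2
    have a5 := ((a3.sqrt.add (a4.add hT')).add (hε.pow 2)).sqrt
    simpa using ((a2.const_mul (√(∫ u, p u ^ 2 ∂gaussianReal 0 1))).const_mul (Real.exp (-m))).add
      (((hε.const_mul (√(∫ u, p u ^ 2 ∂gaussianReal 0 1))).add a5).const_mul (Real.exp (-m)))
  rw [tendsto_iff_norm_sub_tendsto_zero]
  refine squeeze_zero' (Eventually.of_forall fun _ => norm_nonneg _) ?_ hbound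
  filter_upwards [hm, hw, hε.eventually_le_const one_pos] with d h2 h3 h4
  exact abs_integral_langevin_mhAccept_sub_le hθ (ht d) (htε d) h4 (hε0 d) hT0 h3 hpm hp h1 (hH d)
    h2 (hH1 d)

lemma tendsto_integral_langevin_increment_sq {s : ℕ → ℝ} (hs : ∀ᶠ d in atTop, 0 < s d)
    (hsε : ∀ᶠ d in atTop, s d ≤ ε d) (hws : ∀ᶠ d in atTop, ∀ i, w d i ≠ 0 → t d i = s d) :
    Tendsto (fun d => ∫ ω, (w d ⬝ᵥ (langevinProposal θ (t d) ω - ω.1)) ^ 2 / s d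
        * mhAccept (langevinLogRatio θ (t d) (H d) ω) * Real.exp (-H d ω.1) ∂prodGaussian d)
      atTop (𝓝 (2 * Phi (-(|θ - 1 / 2| * √T / 4)))) := by
  have hsq : MemLp (fun u : ℝ => u ^ 2) 2 (gaussianReal 0 1) :=
    (memLp_sq_sub_one_gaussian.add (memLp_const 1)).ae_eq (ae_of_all _ fun u => by simp)
  have hlim := tendsto_integral_langevin_mhAccept hθ hε hε0 ht htε hT hH hH1 hm hΔ hw
    (p := fun u => u ^ 2) (by fun_prop) hsq integral_sq_gaussian
  have hsmall : Tendsto (fun d => 4 * √(ε d) * (1 + 1) * Real.exp (-m)) atTop (𝓝 0) := by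
    simpa using ((hε.sqrt.const_mul 4).mul_const (1 + 1)).mul_const (Real.exp (-m))
  refine tendsto_of_tendsto_of_dist hlim
    (squeeze_zero' (Eventually.of_forall fun _ => dist_nonneg) ?_ hsmall)
  filter_upwards [hs, hsε, hws, hw, hm, hε.eventually_le_const one_pos] with d h1 h2 h3 h4 h5 h6
  rw [dist_comm, Real.dist_eq]
  refine (abs_integral_langevin_increment_sub_le hθ h1 (h2.trans h6) h4 h3
    (measurable_langevinLogRatio (t d) (hH d)) (hH d) h5).trans ?_
  gcongr

end

/-! ### Reduction to diagonal coordinates -/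

section
variable {d : ℕ} {A V S : Matrix (Fin d) (Fin d) ℝ} {Λ : Fin d → ℝ} {b : Fin d → ℝ} {θ h : ℝ}

lemma mul_transpose_mul_eq_one (hSA : Sᵀ * A * S = 1) : S * Sᵀ * A = 1 := by
  rw [Matrix.mul_assoc]; exact mul_eq_one_comm.mp hSA

lemma one_add_smul_mul_mul (hSA : Sᵀ * A * S = 1) (hSV : S * diagonal Λ * Sᵀ = V) (c : ℝ) :
    (1 + c • (V * A)) * S = S * diagonal (fun i => 1 + c * Λ i) := by
  have h1 : V * A * S = S * diagonal Λ := by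
    rw [← hSV]
    calc _ = S * diagonal Λ * (Sᵀ * A * S) := by simp only [Matrix.mul_assoc]
      _ = _ := by rw [hSA, Matrix.mul_one]
  have h2 : diagonal (fun i => 1 + c * Λ i) = 1 + c • diagonal Λ := by
    ext i j
    by_cases hij : i = j
    · subst hij; simp
    · simp [hij]
  rw [h2, Matrix.add_mul, Matrix.one_mul, Matrix.smul_mul, h1, Matrix.mul_add, Matrix.mul_one,
    Matrix.mul_smul]

lemma transpose_mul_one_add_smul (hSA : Sᵀ * A * S = 1) (hSV : S * diagonal Λ * Sᵀ = V) (c : ℝ) :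
    Sᵀ * (1 + c • (A * V)) = diagonal (fun i => 1 + c * Λ i) * Sᵀ := by
  have h1 : Sᵀ * (A * V) = diagonal Λ * Sᵀ := by
    rw [← hSV]
    calc _ = (Sᵀ * A * S) * (diagonal Λ * Sᵀ) := by simp only [Matrix.mul_assoc]
      _ = _ := by rw [hSA, Matrix.one_mul]
  have h2 : diagonal (fun i => 1 + c * Λ i) = 1 + c • diagonal Λ := by
    ext i j
    by_cases hij : i = j
    · subst hij; simp
    · simp [hij]
  rw [h2, Matrix.add_mul, Matrix.one_mul, Matrix.smul_mul, Matrix.mul_add, Matrix.mul_one,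
    Matrix.mul_smul, h1]

variable {c : ℝ}

lemma diagonal_mul_diagonal_inv {f : Fin d → ℝ} (hf : ∀ i, f i ≠ 0) :
    diagonal f * diagonal (fun i => (f i)⁻¹) = 1 := by
  simp [diagonal_mul_diagonal, hf]

lemma one_add_smul_mul_inv_eq_one (hSA : Sᵀ * A * S = 1) (hSV : S * diagonal Λ * Sᵀ = V)
    (hc : ∀ i, 1 + c * Λ i ≠ 0) :
    (1 + c • (V * A)) * (S * diagonal (fun i => (1 + c * Λ i)⁻¹) * (Sᵀ * A)) = 1 := by
  rw [← Matrix.mul_assoc, ← Matrix.mul_assoc, ← Matrix.mul_assoc, one_add_smul_mul_mul hSA hSV,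
    Matrix.mul_assoc S,
    diagonal_mul_diagonal_inv hc, Matrix.mul_one, mul_transpose_mul_eq_one hSA]

lemma one_add_smul_inv (hSA : Sᵀ * A * S = 1) (hSV : S * diagonal Λ * Sᵀ = V)
    (hc : ∀ i, 1 + c * Λ i ≠ 0) :
    (1 + c • (V * A))⁻¹ = S * diagonal (fun i => (1 + c * Λ i)⁻¹) * (Sᵀ * A) :=
  Matrix.inv_eq_right_inv (one_add_smul_mul_inv_eq_one hSA hSV hc)

lemma one_add_smul_inv_mul_self (hSA : Sᵀ * A * S = 1) (hSV : S * diagonal Λ * Sᵀ = V)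
    (hc : ∀ i, 1 + c * Λ i ≠ 0) :
    (1 + c • (V * A))⁻¹ * (1 + c • (V * A)) = 1 := by
  rw [one_add_smul_inv hSA hSV hc]
  exact mul_eq_one_comm.mp (one_add_smul_mul_inv_eq_one hSA hSV hc)

lemma one_add_smul_inv_mul (hSA : Sᵀ * A * S = 1) (hSV : S * diagonal Λ * Sᵀ = V)
    (hc : ∀ i, 1 + c * Λ i ≠ 0) :
    (1 + c • (V * A))⁻¹ * S = S * diagonal (fun i => (1 + c * Λ i)⁻¹) := by
  rw [one_add_smul_inv hSA hSV hc, Matrix.mul_assoc, hSA, Matrix.mul_one]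

lemma one_add_smul_inv' (hSA : Sᵀ * A * S = 1) (hSV : S * diagonal Λ * Sᵀ = V)
    (hc : ∀ i, 1 + c * Λ i ≠ 0) :
    (1 + c • (A * V))⁻¹ = A * S * diagonal (fun i => (1 + c * Λ i)⁻¹) * Sᵀ := by
  refine Matrix.inv_eq_left_inv ?_
  have hinv : diagonal (fun i => (1 + c * Λ i)⁻¹) * diagonal (fun i => 1 + c * Λ i) = 1 :=
    mul_eq_one_comm.mp (diagonal_mul_diagonal_inv hc)
  rw [Matrix.mul_assoc, transpose_mul_one_add_smul hSA hSV, ← Matrix.mul_assoc,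
    Matrix.mul_assoc (A * S), hinv, Matrix.mul_one, Matrix.mul_assoc]
  exact mul_eq_one_comm.mp (mul_transpose_mul_eq_one hSA)

variable (hSA : Sᵀ * A * S = 1) (hSV : S * diagonal Λ * Sᵀ = V) (hθ : θ ∈ Set.Icc (0 : ℝ) 1)
  (hh : 0 < h) (hΛ : ∀ i, 0 < Λ i)
include hSA hSV hθ hh hΛ

omit hSA hSV in
lemma one_add_mul_ne_zero (i : Fin d) : 1 + θ * h / 2 * Λ i ≠ 0 := by
  have := mul_nonneg (mul_nonneg hθ.1 hh.le) (hΛ i).le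
  linarith

lemma glCov_inv_eq :
    (glCov A V θ h)⁻¹ = A * S * diagonal (fun i => (langevinStd θ (h * Λ i) ^ 2)⁻¹) * Sᵀ * A := by
  have hc := one_add_mul_ne_zero hθ hh hΛ
  have hk (i) : langevinStd θ (h * Λ i) ^ 2
      = (1 + θ * h / 2 * Λ i)⁻¹ * (h * Λ i) * (1 + θ * h / 2 * Λ i)⁻¹ := by
    rw [langevinStd_sq (mul_pos hh (hΛ i)).le]
    rw [show 1 + θ * (h * Λ i) / 2 = 1 + θ * h / 2 * Λ i by ring]
    field_simp
  have hcov : glCov A V θ h = S * diagonal (fun i => langevinStd θ (h * Λ i) ^ 2) * Sᵀ := by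
    rw [glCov, one_add_smul_inv' hSA hSV hc, one_add_smul_inv hSA hSV hc]
    have hV : h • V = S * diagonal (fun i => h * Λ i) * Sᵀ := by
      rw [← hSV, ← Matrix.smul_mul, ← Matrix.mul_smul]
      congr 2
      ext i j
      by_cases hij : i = j
      · subst hij; simp
      · simp [hij]
    rw [hV]
    calc _ = S * diagonal (fun i => (1 + θ * h / 2 * Λ i)⁻¹) * (Sᵀ * A * S)
          * diagonal (fun i => h * Λ i) * (Sᵀ * A * S)
          * diagonal (fun i => (1 + θ * h / 2 * Λ i)⁻¹) * Sᵀ := by simp only [Matrix.mul_assoc]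
      _ = S * (diagonal (fun i => (1 + θ * h / 2 * Λ i)⁻¹) * diagonal (fun i => h * Λ i)
          * diagonal (fun i => (1 + θ * h / 2 * Λ i)⁻¹)) * Sᵀ := by
            rw [hSA]; simp only [Matrix.mul_assoc, Matrix.mul_one]
      _ = _ := by simp only [diagonal_mul_diagonal, hk]
  refine Matrix.inv_eq_right_inv ?_
  have hk0 (i) : langevinStd θ (h * Λ i) ^ 2 ≠ 0 := by
    rw [hk]; exact mul_ne_zero (mul_ne_zero (inv_ne_zero (hc i)) (mul_pos hh (hΛ i)).ne')
      (inv_ne_zero (hc i))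
  rw [hcov]
  calc _ = S * diagonal (fun i => langevinStd θ (h * Λ i) ^ 2) * (Sᵀ * A * S)
        * diagonal (fun i => (langevinStd θ (h * Λ i) ^ 2)⁻¹) * Sᵀ * A := by
          simp only [Matrix.mul_assoc]
    _ = S * (diagonal (fun i => langevinStd θ (h * Λ i) ^ 2)
        * diagonal (fun i => (langevinStd θ (h * Λ i) ^ 2)⁻¹)) * Sᵀ * A := by
          rw [hSA]; simp only [Matrix.mul_assoc, Matrix.one_mul]
    _ = 1 := by
      rw [diagonal_mul_diagonal_inv hk0, Matrix.mul_one, mul_transpose_mul_eq_one hSA]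

lemma glMean_add_mulVec (hAdet : A * A⁻¹ = 1) (u : Fin d → ℝ) :
    glMean A V b θ h (A⁻¹ *ᵥ b + S *ᵥ u)
      = A⁻¹ *ᵥ b + S *ᵥ (fun i => langevinMean θ (h * Λ i) * u i) := by
  have hc := one_add_mul_ne_zero hθ hh hΛ
  have h1 : (1 - ((1 - θ) * h / 2) • (V * A)) *ᵥ (A⁻¹ *ᵥ b) + (h / 2) • V *ᵥ b
      = (1 + (θ * h / 2) • (V * A)) *ᵥ (A⁻¹ *ᵥ b) := by
    have e : (V * A) *ᵥ (A⁻¹ *ᵥ b) = V *ᵥ b := by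
      rw [mulVec_mulVec, Matrix.mul_assoc, hAdet, Matrix.mul_one]
    rw [sub_mulVec, add_mulVec, smul_mulVec, smul_mulVec, e]
    module
  have h2 : (1 - ((1 - θ) * h / 2) • (V * A)) * S
      = S * diagonal (fun i => 1 + -((1 - θ) * h / 2) * Λ i) := by
    rw [← one_add_smul_mul_mul hSA hSV, neg_smul, sub_eq_add_neg]
  have h3 : (1 - ((1 - θ) * h / 2) • (V * A)) *ᵥ (A⁻¹ *ᵥ b + S *ᵥ u) + (h / 2) • V *ᵥ b
      = (1 + (θ * h / 2) • (V * A)) *ᵥ (A⁻¹ *ᵥ b)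
        + (S * diagonal (fun i => 1 + -((1 - θ) * h / 2) * Λ i)) *ᵥ u := by
    rw [mulVec_add, add_right_comm, h1, ← h2, mulVec_mulVec u]
  rw [glMean, h3, mulVec_add, mulVec_mulVec, one_add_smul_inv_mul_self hSA hSV hc, one_mulVec,
    mulVec_mulVec, ← Matrix.mul_assoc, one_add_smul_inv_mul hSA hSV hc, Matrix.mul_assoc,
    diagonal_mul_diagonal, ← mulVec_mulVec]
  congr 2
  ext i
  rw [mulVec_diagonal, langevinMean, show 1 + θ * (h * Λ i) / 2 = 1 + θ * h / 2 * Λ i by ring]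
  ring

lemma glQlog_add_mulVec (hAdet : A * A⁻¹ = 1) (u v : Fin d → ℝ) :
    glQlog A V b θ h (A⁻¹ *ᵥ b + S *ᵥ u) (A⁻¹ *ᵥ b + S *ᵥ v)
      = -(1 / 2) * ∑ i, (v i - langevinMean θ (h * Λ i) * u i) ^ 2
        / langevinStd θ (h * Λ i) ^ 2 := by
  rw [glQlog, glMean_add_mulVec hSA hSV hθ hh hΛ hAdet, glCov_inv_eq hSA hSV hθ hh hΛ,
    add_sub_add_left_eq_sub, ← mulVec_sub]
  set z : Fin d → ℝ := v - fun i => langevinMean θ (h * Λ i) * u i with hz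
  have e : S *ᵥ z ⬝ᵥ (A * S * diagonal (fun i => (langevinStd θ (h * Λ i) ^ 2)⁻¹) * Sᵀ * A) *ᵥ
      (S *ᵥ z) = z ⬝ᵥ diagonal (fun i => (langevinStd θ (h * Λ i) ^ 2)⁻¹) *ᵥ z := by
    rw [mulVec_mulVec, ← vecMul_transpose, ← dotProduct_mulVec, mulVec_mulVec]
    congr 2
    calc _ = (Sᵀ * A * S) * diagonal (fun i => (langevinStd θ (h * Λ i) ^ 2)⁻¹) * (Sᵀ * A * S) := by
          simp only [Matrix.mul_assoc]
      _ = _ := by rw [hSA, Matrix.one_mul, Matrix.mul_one]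
  rw [e]
  congr 1
  refine Finset.sum_congr rfl fun i _ => ?_
  rw [mulVec_diagonal, hz, Pi.sub_apply, div_eq_mul_inv]
  ring

omit hSV hθ hh hΛ in
lemma glPlog_add_mulVec (hAdet : A * A⁻¹ = 1) (hAsymm : Aᵀ = A) (φ : (Fin d → ℝ) → ℝ)
    (u : Fin d → ℝ) :
    glPlog A b φ (A⁻¹ *ᵥ b + S *ᵥ u)
      = 1 / 2 * (b ⬝ᵥ A⁻¹ *ᵥ b) - 1 / 2 * ∑ i, u i ^ 2 - φ (A⁻¹ *ᵥ b + S *ᵥ u) := by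
  have hAb : A *ᵥ (A⁻¹ *ᵥ b) = b := by rw [mulVec_mulVec, hAdet, one_mulVec]
  have e1 : A⁻¹ *ᵥ b ⬝ᵥ A *ᵥ (S *ᵥ u) = b ⬝ᵥ S *ᵥ u := by
    rw [dotProduct_mulVec, ← mulVec_transpose, hAsymm, hAb]
  have e2 : S *ᵥ u ⬝ᵥ A *ᵥ (S *ᵥ u) = ∑ i, u i ^ 2 := by
    rw [mulVec_mulVec, ← vecMul_transpose, ← dotProduct_mulVec, mulVec_mulVec, ← Matrix.mul_assoc,
      hSA, one_mulVec]
    simp [dotProduct, sq]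
  have e3 : A⁻¹ *ᵥ b ⬝ᵥ b = b ⬝ᵥ A⁻¹ *ᵥ b := dotProduct_comm _ _
  rw [glPlog, mulVec_add, add_dotProduct, dotProduct_add, dotProduct_add, hAb, e1, e2, e3,
    dotProduct_add, dotProduct_comm (S *ᵥ u) b]
  ring

lemma glAccept_add_mulVec (hAdet : A * A⁻¹ = 1) (hAsymm : Aᵀ = A) (φ : (Fin d → ℝ) → ℝ)
    (ω : (Fin d → ℝ) × (Fin d → ℝ)) :
    glAccept A V b φ θ h (A⁻¹ *ᵥ b + S *ᵥ ω.1)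
        (A⁻¹ *ᵥ b + S *ᵥ langevinProposal θ (fun i => h * Λ i) ω)
      = mhAccept (langevinLogRatio θ (fun i => h * Λ i) (fun u => φ (A⁻¹ *ᵥ b + S *ᵥ u)) ω) := by
  set y := langevinProposal θ (fun i => h * Λ i) ω with hy
  rw [glAccept, mhAccept]
  congr 2
  rw [glPlog_add_mulVec hSA hAdet hAsymm, glPlog_add_mulVec hSA hAdet hAsymm,
    glQlog_add_mulVec hSA hSV hθ hh hΛ hAdet, glQlog_add_mulVec hSA hSV hθ hh hΛ hAdet,
    langevinLogRatio, ← hy]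
  have key (i) : (θ - 1 / 2) / 4 * (h * Λ i) * (y i ^ 2 - ω.1 i ^ 2)
      = -(1 / 2) * y i ^ 2 + 1 / 2 * ω.1 i ^ 2
        - 1 / 2 * ((ω.1 i - langevinMean θ (h * Λ i) * y i) ^ 2 / langevinStd θ (h * Λ i) ^ 2)
        + 1 / 2 * ((y i - langevinMean θ (h * Λ i) * ω.1 i) ^ 2 / langevinStd θ (h * Λ i) ^ 2) := by
    have ht := mul_pos hh (hΛ i)
    have h1 := langevinMean_sq_add_langevinStd_sq hθ ht.le
    have h2 := langevinStd_sq (θ := θ) ht.le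
    have hD := one_le_langevin_denom hθ ht.le
    have hq : 0 < 1 / (1 + θ * (h * Λ i) / 2) ^ 2 := by positivity
    generalize 1 / (1 + θ * (h * Λ i) / 2) ^ 2 = q at h1 h2 hq
    have hg : langevinMean θ (h * Λ i) ^ 2
        = 1 - (h * Λ i) * q + (1 - 2 * θ) / 4 * (h * Λ i) ^ 2 * q := by linarith
    have hsplit : (y i - langevinMean θ (h * Λ i) * ω.1 i) ^ 2
        = (ω.1 i - langevinMean θ (h * Λ i) * y i) ^ 2
          + (1 - langevinMean θ (h * Λ i) ^ 2) * (y i ^ 2 - ω.1 i ^ 2) := by ring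
    rw [hsplit, hg, h2]
    have := hΛ i
    field_simp
    ring
  simp only [key, Finset.sum_add_distrib, Finset.sum_sub_distrib, ← Finset.mul_sum]
  ring

lemma yGL_add_mulVec {Vh Q : Matrix (Fin d) (Fin d) ℝ} (hAdet : A * A⁻¹ = 1)
    (hVh : Vh = S * diagonal (fun i => √(Λ i)) * Qᵀ) (u η : Fin d → ℝ) :
    yGL A V Vh b θ h (A⁻¹ *ᵥ b + S *ᵥ u) η
      = A⁻¹ *ᵥ b + S *ᵥ langevinProposal θ (fun i => h * Λ i) (u, Qᵀ *ᵥ η) := by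
  have hc := one_add_mul_ne_zero hθ hh hΛ
  rw [yGL, glMean_add_mulVec hSA hSV hθ hh hΛ hAdet, add_assoc]
  congr 1
  rw [mulVec_mulVec, hVh, ← Matrix.mul_assoc, ← Matrix.mul_assoc, one_add_smul_inv_mul hSA hSV hc,
    Matrix.mul_assoc S, diagonal_mul_diagonal, ← mulVec_mulVec, ← mulVec_mulVec, ← mulVec_smul,
    ← mulVec_add]
  congr 1
  ext i
  simp only [Pi.add_apply, Pi.smul_apply, smul_eq_mul, mulVec_diagonal, arProposal, langevinStd]
  rw [Real.sqrt_mul hh.le, show 1 + θ * (h * Λ i) / 2 = 1 + θ * h / 2 * Λ i by ring]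
  ring

end

/-! ### The eigenframe -/

section
variable {d : ℕ} {A V Vh Q R : Matrix (Fin d) (Fin d) ℝ} {lam : Fin d → ℝ} {b : Fin d → ℝ}
  {θ h : ℝ} {φ : (Fin d → ℝ) → ℝ}

/-- The change of coordinates `V^{1/2} Q Λ^{-1}` diagonalizing `A` and `V` simultaneously. -/
noncomputable def eigenFrame (Vh Q : Matrix (Fin d) (Fin d) ℝ) (lam : Fin d → ℝ) :
    Matrix (Fin d) (Fin d) ℝ :=
  Vh * Q * diagonal (fun i => (lam i)⁻¹)

lemma eigenFrame_transpose_mul_mul (hVhs : Vhᵀ = Vh) (hlam : ∀ i, 0 < lam i)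
    (hB : Qᵀ * (Vh * A * Vh) * Q = diagonal (fun i => lam i ^ 2)) :
    (eigenFrame Vh Q lam)ᵀ * A * eigenFrame Vh Q lam = 1 := by
  have hl (i) := (hlam i).ne'
  calc _ = diagonal (fun i => (lam i)⁻¹) * (Qᵀ * (Vh * A * Vh) * Q)
        * diagonal (fun i => (lam i)⁻¹) := by
        simp only [eigenFrame, transpose_mul, diagonal_transpose, hVhs, Matrix.mul_assoc]
    _ = 1 := by
        rw [hB, diagonal_mul_diagonal, diagonal_mul_diagonal, ← diagonal_one]
        congr 1
        ext i
        have := hl i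
        field_simp

lemma eigenFrame_mul_diagonal_mul_transpose (hVhs : Vhᵀ = Vh) (hV : Vh * Vh = V) (hQ : Qᵀ * Q = 1)
    (hlam : ∀ i, 0 < lam i) :
    eigenFrame Vh Q lam * diagonal (fun i => lam i ^ 2) * (eigenFrame Vh Q lam)ᵀ = V := by
  have hl (i) := (hlam i).ne'
  calc _ = Vh * (Q * (diagonal (fun i => (lam i)⁻¹) * diagonal (fun i => lam i ^ 2)
        * diagonal (fun i => (lam i)⁻¹)) * Qᵀ) * Vh := by
        simp only [eigenFrame, transpose_mul, diagonal_transpose, hVhs, Matrix.mul_assoc]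
    _ = V := by
        have e : (fun i => (lam i)⁻¹ * lam i ^ 2 * (lam i)⁻¹) = fun _ => 1 := by
          ext i
          have := hl i
          field_simp
        rw [diagonal_mul_diagonal, diagonal_mul_diagonal, e, diagonal_one, Matrix.mul_one,
          mul_eq_one_comm.mp hQ, Matrix.mul_one, hV]

lemma eq_eigenFrame_mul (hQ : Qᵀ * Q = 1) (hlam : ∀ i, 0 < lam i) :
    Vh = eigenFrame Vh Q lam * diagonal (fun i => √(lam i ^ 2)) * Qᵀ := by
  have e : (fun i => (lam i)⁻¹ * √(lam i ^ 2)) = fun _ => 1 := by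
    ext i
    rw [Real.sqrt_sq (hlam i).le, inv_mul_cancel₀ (hlam i).ne']
  rw [eigenFrame, Matrix.mul_assoc (Vh * Q), diagonal_mul_diagonal, e, diagonal_one, Matrix.mul_one,
    Matrix.mul_assoc, mul_eq_one_comm.mp hQ, Matrix.mul_one]

lemma snorm_mulVec (hQ : Qᵀ * Q = 1) (hlam : ∀ i, 0 < lam i) (s : ℝ) (v : Fin d → ℝ) :
    snorm Q lam s (Q *ᵥ (fun i => (lam i)⁻¹ * v i)) = √(∑ i, lam i ^ (4 * s - 2) * v i ^ 2) := by
  have e : Bpow Q lam s *ᵥ (Q *ᵥ (fun i => (lam i)⁻¹ * v i))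
      = Q *ᵥ (fun i => lam i ^ (2 * s) * ((lam i)⁻¹ * v i)) := by
    rw [Bpow, mulVec_mulVec, Matrix.mul_assoc, hQ, Matrix.mul_one, ← mulVec_mulVec]
    congr 1
    ext i
    rw [mulVec_diagonal]
  rw [snorm, e, dotProduct_mulVec, ← mulVec_transpose, mulVec_mulVec, hQ, one_mulVec]
  congr 1
  refine Finset.sum_congr rfl fun i _ => ?_
  have : lam i ^ (4 * s - 2) = lam i ^ (2 * s) * lam i ^ (2 * s) * ((lam i)⁻¹ * (lam i)⁻¹) := by
    rw [← Real.rpow_add (hlam i), ← mul_inv, ← sq, ← Real.rpow_natCast, ← Real.rpow_neg (hlam i).le,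
      ← Real.rpow_add (hlam i)]
    congr 1
    push_cast
    ring
  rw [this]
  ring

lemma add_eigenFrame_mulVec (hVu : IsUnit Vh.det) (u : Fin d → ℝ) :
    A⁻¹ *ᵥ b + eigenFrame Vh Q lam *ᵥ u
      = Vh *ᵥ ((Vh * A * Vh)⁻¹ *ᵥ (Vh *ᵥ b) + Q *ᵥ (fun i => (lam i)⁻¹ * u i)) := by
  rw [mulVec_add, mulVec_mulVec, mulVec_mulVec, mulVec_mulVec]
  have e : Vh * (Vh * A * Vh)⁻¹ * Vh = A⁻¹ := by
    rw [Matrix.mul_inv_rev, Matrix.mul_inv_rev, ← Matrix.mul_assoc, Matrix.mul_nonsing_inv _ hVu,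
      Matrix.one_mul, Matrix.mul_assoc, Matrix.nonsing_inv_mul _ hVu, Matrix.mul_one]
  rw [e, eigenFrame, ← mulVec_mulVec]
  congr 2
  ext i
  rw [mulVec_diagonal]

/-- The potential in coordinates in which the dynamics is diagonal. -/
noncomputable def framePotential (A Vh Q : Matrix (Fin d) (Fin d) ℝ) (lam b : Fin d → ℝ)
    (φ : (Fin d → ℝ) → ℝ) (u : Fin d → ℝ) : ℝ :=
  φ (A⁻¹ *ᵥ b + eigenFrame Vh Q lam *ᵥ u)

lemma measurable_framePotential (hφ : Measurable φ) :
    Measurable (framePotential A Vh Q lam b φ) := by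
  unfold framePotential
  exact hφ.comp (by fun_prop)

lemma abs_framePotential_sub_le (hVu : IsUnit Vh.det) (hQ : Qᵀ * Q = 1)
    (hlam : ∀ i, 0 < lam i) {δ : ℝ → ℝ → ℝ} {s s' : ℝ}
    (hlip : ∀ x y : Fin d → ℝ, |φ (Vh *ᵥ x) - φ (Vh *ᵥ y)|
      ≤ δ (snorm Q lam s (x - (Vh * A * Vh)⁻¹ *ᵥ (Vh *ᵥ b)))
          (snorm Q lam s (y - (Vh * A * Vh)⁻¹ *ᵥ (Vh *ᵥ b))) * snorm Q lam s' (x - y))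
    (x y : Fin d → ℝ) :
    |framePotential A Vh Q lam b φ x - framePotential A Vh Q lam b φ y|
      ≤ δ (√(∑ i, lam i ^ (4 * s - 2) * x i ^ 2)) (√(∑ i, lam i ^ (4 * s - 2) * y i ^ 2))
        * √(∑ i, lam i ^ (4 * s' - 2) * (x i - y i) ^ 2) := by
  have := hlip ((Vh * A * Vh)⁻¹ *ᵥ (Vh *ᵥ b) + Q *ᵥ (fun i => (lam i)⁻¹ * x i))
    ((Vh * A * Vh)⁻¹ *ᵥ (Vh *ᵥ b) + Q *ᵥ (fun i => (lam i)⁻¹ * y i))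
  rw [← add_eigenFrame_mulVec hVu, ← add_eigenFrame_mulVec hVu, add_sub_cancel_left,
    add_sub_cancel_left, add_sub_add_left_eq_sub, ← mulVec_sub, snorm_mulVec hQ hlam,
    snorm_mulVec hQ hlam] at this
  have e : ((fun i => (lam i)⁻¹ * x i) - fun i => (lam i)⁻¹ * y i)
      = fun i => (lam i)⁻¹ * (x i - y i) := by
    ext i; simp only [Pi.sub_apply]; ring
  rwa [e, snorm_mulVec hQ hlam] at this

lemma integral_prodGaussian_comp_mulVec {O P : Matrix (Fin d) (Fin d) ℝ} (hO : O * Oᵀ = 1)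
    (hP : P * Pᵀ = 1) {F : (Fin d → ℝ) × (Fin d → ℝ) → ℝ} (hF : Measurable F) :
    ∫ ω, F (O *ᵥ ω.1, P *ᵥ ω.2) ∂prodGaussian d = ∫ ω, F ω ∂prodGaussian d := by
  have h : MeasurePreserving (Prod.map (fun x => O *ᵥ x) (fun x => P *ᵥ x)) (prodGaussian d)
      (prodGaussian d) := (stdGaussian_map_mulVec hO).prod (stdGaussian_map_mulVec hP)
  conv_rhs => rw [← h.map_eq]
  rw [integral_map h.aemeasurable hF.aestronglyMeasurable]
  rfl

variable (hA : A.PosDef) (hVh : Vh.PosDef) (hV : Vh * Vh = V) (hQ : Qᵀ * Q = 1)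
  (hB : Qᵀ * (Vh * A * Vh) * Q = diagonal (fun i => lam i ^ 2)) (hlam : ∀ i, 0 < lam i)
  (hR : R * Rᵀ = A⁻¹)
include hA hVh hB hlam hR

/-- Any square root of the covariance factors through the eigenframe and an orthogonal matrix. -/
lemma exists_eq_eigenFrame_mul :
    ∃ O : Matrix (Fin d) (Fin d) ℝ, O * Oᵀ = 1 ∧ R = eigenFrame Vh Q lam * O := by
  have hAu : IsUnit A.det := (Matrix.isUnit_iff_isUnit_det A).mp hA.isUnit
  have hVhs : Vhᵀ = Vh := hVh.isHermitian
  have hSA := eigenFrame_transpose_mul_mul hVhs hlam hB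
  have hAs : Aᵀ = A := hA.isHermitian
  refine ⟨(eigenFrame Vh Q lam)ᵀ * A * R, ?_, ?_⟩
  · calc _ = (eigenFrame Vh Q lam)ᵀ * A * (R * Rᵀ) * (A * eigenFrame Vh Q lam) := by
          simp only [transpose_mul, transpose_transpose, hAs, Matrix.mul_assoc]
      _ = (eigenFrame Vh Q lam)ᵀ * A * eigenFrame Vh Q lam := by
          rw [hR, Matrix.mul_assoc, ← Matrix.mul_assoc A⁻¹, Matrix.nonsing_inv_mul _ hAu,
            Matrix.one_mul]
      _ = 1 := hSA
  · rw [← Matrix.mul_assoc, ← Matrix.mul_assoc, mul_transpose_mul_eq_one hSA, Matrix.one_mul]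

lemma integral_exp_neg_framePotential (hφ : Measurable φ) :
    ∫ x, Real.exp (-framePotential A Vh Q lam b φ x) ∂_root_.stdGaussian d
      = ∫ ξ, Real.exp (-(φ (xeq A b R ξ))) ∂_root_.stdGaussian d := by
  obtain ⟨O, hO, hRO⟩ := exists_eq_eigenFrame_mul hA hVh hB hlam hR
  have h := stdGaussian_map_mulVec hO
  have hm : Measurable fun x => Real.exp (-framePotential A Vh Q lam b φ x) :=
    (measurable_framePotential hφ).neg.exp
  conv_lhs => rw [← h.map_eq]
  rw [integral_map h.aemeasurable hm.aestronglyMeasurable]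
  simp only [framePotential, xeq, hRO, mulVec_mulVec]

include hV hQ

/-- Equilibrium expectations of functions of the increment, in diagonal coordinates. -/
lemma integral_glAccept_eq (hθ : θ ∈ Set.Icc (0 : ℝ) 1) (hh : 0 < h) (hφ : Measurable φ)
    {f : (Fin d → ℝ) → ℝ} (hf : Measurable f) :
    ∫ ω, f (yGL A V Vh b θ h (xeq A b R ω.1) ω.2 - xeq A b R ω.1)
        * glAccept A V b φ θ h (xeq A b R ω.1) (yGL A V Vh b θ h (xeq A b R ω.1) ω.2)
        * Real.exp (-(φ (xeq A b R ω.1))) ∂prodGaussian d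
      = ∫ ω, f (eigenFrame Vh Q lam *ᵥ (langevinProposal θ (fun i => h * lam i ^ 2) ω - ω.1))
        * mhAccept (langevinLogRatio θ (fun i => h * lam i ^ 2) (framePotential A Vh Q lam b φ) ω)
        * Real.exp (-framePotential A Vh Q lam b φ ω.1) ∂prodGaussian d := by
  obtain ⟨O, hO, hRO⟩ := exists_eq_eigenFrame_mul hA hVh hB hlam hR
  have hAu : IsUnit A.det := (Matrix.isUnit_iff_isUnit_det A).mp hA.isUnit
  have hAdet : A * A⁻¹ = 1 := Matrix.mul_nonsing_inv _ hAu
  have hVhs : Vhᵀ = Vh := hVh.isHermitian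
  have hSA := eigenFrame_transpose_mul_mul hVhs hlam hB
  have hSV := eigenFrame_mul_diagonal_mul_transpose hVhs hV hQ hlam
  have hAs : Aᵀ = A := hA.isHermitian
  have hΛ (i) : 0 < lam i ^ 2 := pow_pos (hlam i) 2
  have hx (ξ : Fin d → ℝ) : xeq A b R ξ = A⁻¹ *ᵥ b + eigenFrame Vh Q lam *ᵥ (O *ᵥ ξ) := by
    rw [xeq, hRO, mulVec_mulVec]
  have hmeas : Measurable fun ω : (Fin d → ℝ) × (Fin d → ℝ) =>
      f (eigenFrame Vh Q lam *ᵥ (langevinProposal θ (fun i => h * lam i ^ 2) ω - ω.1))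
        * mhAccept (langevinLogRatio θ (fun i => h * lam i ^ 2) (framePotential A Vh Q lam b φ) ω)
        * Real.exp (-framePotential A Vh Q lam b φ ω.1) := by
    have hH := measurable_framePotential (A := A) (Vh := Vh) (Q := Q) (lam := lam) (b := b) hφ
    refine ((hf.comp (by fun_prop)).mul
      (measurable_mhAccept.comp (measurable_langevinLogRatio _ hH))).mul
      (hH.comp measurable_fst).neg.exp
  rw [← integral_prodGaussian_comp_mulVec hO (P := Qᵀ) (by rwa [transpose_transpose]) hmeas]
  congr 1
  ext ω
  simp only [hx]
  rw [yGL_add_mulVec hSA hSV hθ hh hΛ hAdet (eq_eigenFrame_mul hQ hlam),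
    add_sub_add_left_eq_sub, ← mulVec_sub]
  congr 2
  exact glAccept_add_mulVec hSA hSV hθ hh hΛ hAdet hAs φ (O *ᵥ ω.1, Qᵀ *ᵥ ω.2)

end

section
variable {d : ℕ} {A Vh Q : Matrix (Fin d) (Fin d) ℝ} {lam q : Fin d → ℝ} {i₀ : Fin d}
  (hQ : Qᵀ * Q = 1) (hB : Qᵀ * (Vh * A * Vh) * Q = diagonal (fun i => lam i ^ 2))
include hQ hB

omit hB in
lemma transpose_mulVec_dot_self (hq : q ⬝ᵥ q = 1) : Qᵀ *ᵥ q ⬝ᵥ Qᵀ *ᵥ q = 1 := by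
  rw [dotProduct_mulVec, ← mulVec_transpose, mulVec_mulVec, transpose_transpose,
    mul_eq_one_comm.mp hQ, one_mulVec, hq]

/-- An eigenvector of `B` is supported on coordinates with the same eigenvalue. -/
lemma sq_eq_of_transpose_mulVec_ne_zero (hq : (Vh * A * Vh) *ᵥ q = lam i₀ ^ 2 • q) (i : Fin d)
    (hi : (Qᵀ *ᵥ q) i ≠ 0) : lam i ^ 2 = lam i₀ ^ 2 := by
  have h1 : diagonal (fun i => lam i ^ 2) *ᵥ (Qᵀ *ᵥ q) = lam i₀ ^ 2 • Qᵀ *ᵥ q := by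
    rw [← hB, mulVec_mulVec, Matrix.mul_assoc, mul_eq_one_comm.mp hQ, Matrix.mul_one,
      ← mulVec_mulVec, hq, mulVec_smul]
  have h2 := congrFun h1 i
  rw [mulVec_diagonal, Pi.smul_apply, smul_eq_mul] at h2
  exact mul_right_cancel₀ hi h2

lemma dot_inv_mulVec_eigenFrame (hVu : IsUnit Vh.det) (hlam : ∀ i, 0 < lam i)
    (hq : (Vh * A * Vh) *ᵥ q = lam i₀ ^ 2 • q) (v : Fin d → ℝ) :
    q ⬝ᵥ Vh⁻¹ *ᵥ (eigenFrame Vh Q lam *ᵥ v) = (lam i₀)⁻¹ * (Qᵀ *ᵥ q ⬝ᵥ v) := by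
  rw [eigenFrame, mulVec_mulVec, ← Matrix.mul_assoc, ← Matrix.mul_assoc,
    Matrix.nonsing_inv_mul _ hVu, Matrix.one_mul, ← mulVec_mulVec, dotProduct_mulVec,
    ← mulVec_transpose, dotProduct, dotProduct, Finset.mul_sum]
  refine Finset.sum_congr rfl fun i _ => ?_
  rw [mulVec_diagonal]
  by_cases hi : (Qᵀ *ᵥ q) i = 0
  · simp [hi]
  · have := sq_eq_of_transpose_mulVec_ne_zero hQ hB hq i hi
    rw [(pow_left_inj₀ (hlam i).le (hlam i₀).le two_ne_zero).mp this]
    ring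

end

/-! ### Step size and spectral growth -/

lemma rpow_le_const_mul_rpow {c x a a' : ℝ} (hc : 0 < c) (hx : c ≤ x) (ha : a ≤ a') :
    x ^ a ≤ c ^ (a - a') * x ^ a' := by
  have hx0 := hc.trans_le hx
  calc x ^ a = x ^ (a - a') * x ^ a' := by rw [← Real.rpow_add hx0, sub_add_cancel]
    _ ≤ _ := mul_le_mul_of_nonneg_right
      (Real.rpow_le_rpow_of_nonpos hc hx (sub_nonpos.mpr ha)) (Real.rpow_nonneg hx0.le _)

section
variable {c C κ l τ : ℝ} {lam : ∀ d : ℕ, Fin d → ℝ}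

lemma step_pos (hl : 0 < l) {d : ℕ} (hd : 0 < d) :
    0 < l ^ 2 * (d : ℝ) ^ (-(1/3 : ℝ) - 2 * κ) := by
  have : (0 : ℝ) < d := Nat.cast_pos.mpr hd
  positivity

lemma le_of_mul_rpow_le {x : ℝ} (hκ : 0 ≤ κ) (hc : 0 < c) {i : ℕ}
    (h : c * ((i : ℝ) + 1) ^ κ ≤ x) : c ≤ x := by
  refine le_trans (le_mul_of_one_le_right hc.le (Real.one_le_rpow ?_ hκ)) h
  linarith [(Nat.cast_nonneg i : (0 : ℝ) ≤ i)]

lemma step_mul_sq_le {x : ℝ} (hκ : 0 ≤ κ) (hC : 0 < C) (hx : 0 < x) {d : ℕ} (i : Fin d)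
    (h : x ≤ C * ((i : ℕ) + 1 : ℝ) ^ κ) :
    l ^ 2 * (d : ℝ) ^ (-(1/3 : ℝ) - 2 * κ) * x ^ 2
      ≤ l ^ 2 * C ^ 2 * (d : ℝ) ^ (-(1/3 : ℝ)) := by
  have hd : (0 : ℝ) < d := Nat.cast_pos.mpr i.pos
  have hi : ((i : ℕ) + 1 : ℝ) ≤ d := by exact_mod_cast i.isLt
  have hxd : x ≤ C * (d : ℝ) ^ κ := h.trans (by gcongr)
  calc _ ≤ l ^ 2 * (d : ℝ) ^ (-(1/3 : ℝ) - 2 * κ) * (C * (d : ℝ) ^ κ) ^ 2 := by gcongr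
    _ = l ^ 2 * C ^ 2 * ((d : ℝ) ^ (-(1/3 : ℝ) - 2 * κ) * ((d : ℝ) ^ κ * (d : ℝ) ^ κ)) := by ring
    _ = _ := by
      rw [← Real.rpow_add hd, ← Real.rpow_add hd]
      ring_nf

lemma tendsto_step_bound : Tendsto (fun d : ℕ => l ^ 2 * C ^ 2 * (d : ℝ) ^ (-(1/3 : ℝ)))
    atTop (𝓝 0) := by
  simpa using ((tendsto_rpow_neg_atTop (by norm_num : (0 : ℝ) < 1/3)).comp
    tendsto_natCast_atTop_atTop).const_mul (l ^ 2 * C ^ 2)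

lemma tendsto_sum_step_mul_sq_cube
    (hτ : Tendsto (fun d : ℕ => (d : ℝ) ^ (-6 * κ - 1) * ∑ i, lam d i ^ 6) atTop (𝓝 τ)) :
    Tendsto (fun d : ℕ => ∑ i, (l ^ 2 * (d : ℝ) ^ (-(1/3 : ℝ) - 2 * κ) * lam d i ^ 2) ^ 3)
      atTop (𝓝 (l ^ 6 * τ)) := by
  refine (hτ.const_mul (l ^ 6)).congr' ?_
  filter_upwards [eventually_gt_atTop 0] with d hd
  rw [← mul_assoc, Finset.mul_sum]
  refine Finset.sum_congr rfl fun i _ => ?_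
  have : (d : ℝ) ^ (-6 * κ - 1) = ((d : ℝ) ^ (-(1/3 : ℝ) - 2 * κ)) ^ 3 := by
    rw [← Real.rpow_mul_natCast (Nat.cast_nonneg d)]
    congr 1
    push_cast
    ring
  rw [this]
  ring

lemma abs_mul_sqrt_pow_six_mul (hl : 0 < l) (a : ℝ) :
    -(|a| * √(l ^ 6 * τ) / 4) = -(l ^ 3) * |a| * √τ / 4 := by
  rw [Real.sqrt_mul (by positivity), show l ^ 6 = (l ^ 3) ^ 2 by ring, Real.sqrt_sq (by positivity)]
  ring

lemma eventually_sum_rpow_le {L a a' : ℝ} (hc : 0 < c) (hlam : ∀ d i, c ≤ lam d i)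
    (h : Tendsto (fun d : ℕ => ∑ i, lam d i ^ a') atTop (𝓝 L)) (ha : a ≤ a') :
    ∀ᶠ d in atTop, ∑ i, lam d i ^ a ≤ c ^ (a - a') * (L + 1) := by
  filter_upwards [h.eventually_le_const (lt_add_one L)] with d hd
  calc ∑ i, lam d i ^ a ≤ ∑ i, c ^ (a - a') * lam d i ^ a' :=
        Finset.sum_le_sum fun i _ => rpow_le_const_mul_rpow hc (hlam d i) ha
    _ ≤ _ := by
        rw [← Finset.mul_sum]
        gcongr

end

/-- Theorem: optimal scaling of the generalized Langevin algorithm.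
Under Assumptions 1 and 2 for `ψ_d(x) = φ_d(V^{1/2}x)` with the `B = V^{1/2}AV^{1/2}`
norms, eigenvalue growth `c iᵏ ≤ λ_i ≤ C iᵏ` and `h = l²d^{-1/3-2κ}`, the algorithm in
equilibrium satisfies `E[α(x,y)] → 2Φ(-l³|θ-½|√τ/4)` and
`E[|q_iᵀV^{-1/2}(x'-x)|²] = 2hΦ(-l³|θ-½|√τ/4) + o(h)` as `d → ∞`. -/
theorem general_langevin_optimal_scaling
    (A V Vh : ∀ d : ℕ, Matrix (Fin d) (Fin d) ℝ)
    (b : ∀ d : ℕ, Fin d → ℝ)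
    (Q R : ∀ d : ℕ, Matrix (Fin d) (Fin d) ℝ)
    (lam : ∀ d : ℕ, Fin d → ℝ)
    (φ : ∀ d : ℕ, (Fin d → ℝ) → ℝ)
    (θ : ℝ) (hθ : θ ∈ Set.Icc (0 : ℝ) 1)
    (hA : ∀ d, (A d).PosDef) (hV : ∀ d, (V d).PosDef)
    (hVh : ∀ d, (Vh d).PosDef ∧ Vh d * Vh d = V d)
    (hQ : ∀ d, (Q d)ᵀ * Q d = 1)
    (hdB : ∀ d, ((Q d)ᵀ * (Vh d * A d * Vh d) * Q d).IsDiag)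
    (hlam : ∀ d i, 0 < lam d i ∧
      lam d i ^ 2 = ((Q d)ᵀ * (Vh d * A d * Vh d) * Q d) i i)
    (hR : ∀ d, R d * (R d)ᵀ = (A d)⁻¹)
    (hφmeas : ∀ d, Measurable (φ d))
    (hnorm : ∀ d, ∫ ξ, Real.exp (-(φ d (xeq (A d) (b d) (R d) ξ))) ∂stdGaussian d = 1)
    -- spectral growth of the eigenvalues of B (equivalently of VA)
    (c C κ : ℝ) (hc : 0 < c) (hC : 0 < C) (hκ : 0 ≤ κ)
    (hbound : ∀ d (i : Fin d),
      c * ((i : ℕ) + 1 : ℝ) ^ κ ≤ lam d i ∧ lam d i ≤ C * ((i : ℕ) + 1 : ℝ) ^ κ)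
    -- Assumption 1 for ψ_d(x) = φ_d(V^{1/2}x), with |·|_s = |B^s ·|
    (m s s' s'' Cc pp : ℝ) (hCc : 0 < Cc) (hpp : 0 < pp)
    (δfun : ℝ → ℝ → ℝ) (hδnn : ∀ a cc, 0 ≤ δfun a cc)
    (hδloc : ∀ Rad : ℝ, ∃ K, ∀ a cc : ℝ, |a| ≤ Rad → |cc| ≤ Rad → δfun a cc ≤ K)
    (hlower : ∀ᶠ d in atTop, ∀ x : Fin d → ℝ, m ≤ φ d ((Vh d).mulVec x))
    (hlip : ∀ᶠ d in atTop, ∀ x y : Fin d → ℝ,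
      |φ d ((Vh d).mulVec x) - φ d ((Vh d).mulVec y)| ≤
        δfun (snorm (Q d) (lam d) s
                (x - (Vh d * A d * Vh d)⁻¹.mulVec ((Vh d).mulVec (b d))))
             (snorm (Q d) (lam d) s
                (y - (Vh d * A d * Vh d)⁻¹.mulVec ((Vh d).mulVec (b d))))
          * snorm (Q d) (lam d) s' (x - y))
    (hgrow : ∀ᶠ d in atTop, ∀ x : Fin d → ℝ,
      |φ d ((Vh d).mulVec x)| ≤ Cc * (1 + snorm (Q d) (lam d) s''
          (x - (Vh d * A d * Vh d)⁻¹.mulVec ((Vh d).mulVec (b d))) ^ pp))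
    -- Assumption 2 with r = max{s, s', s''}
    (L2 : ℝ)
    (hA2 : Tendsto (fun d : ℕ => ∑ i, lam d i ^ (4 * max s (max s' s'') - 1))
      atTop (𝓝 L2))
    -- step size h = l² d^{-1/3 - 2κ} and τ = lim d^{-6κ-1} Σ λ_i⁶
    (l τ : ℝ) (hl : 0 < l)
    (hτ : Tendsto (fun d : ℕ => (d : ℝ) ^ (-6 * κ - 1) * ∑ i, lam d i ^ 6)
      atTop (𝓝 τ))
    -- the fixed direction: a normalized eigenvector of B for the eigenvalue λ_{i0}²
    (i0 : ℕ) (qv : ∀ d : ℕ, Fin d → ℝ)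
    (hqv : ∀ d (hd : i0 < d),
      (Vh d * A d * Vh d).mulVec (qv d) = (lam d ⟨i0, hd⟩) ^ 2 • qv d ∧
        qv d ⬝ᵥ qv d = 1) :
    Tendsto (fun d : ℕ =>
        ∫ ω, glAccept (A d) (V d) (b d) (φ d) θ
              (l ^ 2 * (d : ℝ) ^ (-(1/3 : ℝ) - 2 * κ))
              (xeq (A d) (b d) (R d) ω.1)
              (yGL (A d) (V d) (Vh d) (b d) θ
                (l ^ 2 * (d : ℝ) ^ (-(1/3 : ℝ) - 2 * κ))
                (xeq (A d) (b d) (R d) ω.1) ω.2)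
            * Real.exp (-(φ d (xeq (A d) (b d) (R d) ω.1))) ∂prodGaussian d)
      atTop (𝓝 (2 * Phi (-(l ^ 3) * |θ - 1/2| * Real.sqrt τ / 4))) ∧
    (fun d : ℕ =>
        (∫ ω, (qv d ⬝ᵥ (Vh d)⁻¹.mulVec
              (yGL (A d) (V d) (Vh d) (b d) θ
                  (l ^ 2 * (d : ℝ) ^ (-(1/3 : ℝ) - 2 * κ))
                  (xeq (A d) (b d) (R d) ω.1) ω.2
                - xeq (A d) (b d) (R d) ω.1)) ^ 2
            * glAccept (A d) (V d) (b d) (φ d) θ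
                (l ^ 2 * (d : ℝ) ^ (-(1/3 : ℝ) - 2 * κ))
                (xeq (A d) (b d) (R d) ω.1)
                (yGL (A d) (V d) (Vh d) (b d) θ
                  (l ^ 2 * (d : ℝ) ^ (-(1/3 : ℝ) - 2 * κ))
                  (xeq (A d) (b d) (R d) ω.1) ω.2)
            * Real.exp (-(φ d (xeq (A d) (b d) (R d) ω.1))) ∂prodGaussian d)
          - 2 * (l ^ 2 * (d : ℝ) ^ (-(1/3 : ℝ) - 2 * κ))
              * Phi (-(l ^ 3) * |θ - 1/2| * Real.sqrt τ / 4))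
      =o[atTop] (fun d : ℕ => l ^ 2 * (d : ℝ) ^ (-(1/3 : ℝ) - 2 * κ)) := by
  set h : ℕ → ℝ := fun d => l ^ 2 * (d : ℝ) ^ (-(1/3 : ℝ) - 2 * κ) with hh
  set t : ∀ d : ℕ, Fin d → ℝ := fun d i => h d * lam d i ^ 2 with ht
  set ε : ℕ → ℝ := fun d => l ^ 2 * C ^ 2 * (d : ℝ) ^ (-(1/3 : ℝ)) with hε
  set H : ∀ d : ℕ, (Fin d → ℝ) → ℝ := fun d =>
    framePotential (A d) (Vh d) (Q d) (lam d) (b d) (φ d) with hH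
  set w : ∀ d : ℕ, Fin d → ℝ := fun d => (Q d)ᵀ *ᵥ qv d with hw
  set σ : ℕ → ℝ := fun d => if hd : i0 < d then h d * lam d ⟨i0, hd⟩ ^ 2 else 1 with hσ
  have hlam0 (d : ℕ) (i : Fin d) : 0 < lam d i := (hlam d i).1
  have hlamc (d : ℕ) (i : Fin d) : c ≤ lam d i := le_of_mul_rpow_le hκ hc (hbound d i).1
  have hVu (d : ℕ) : IsUnit (Vh d).det := (Matrix.isUnit_iff_isUnit_det _).mp (hVh d).1.isUnit
  have hB (d : ℕ) : (Q d)ᵀ * (Vh d * A d * Vh d) * Q d = diagonal (fun i => lam d i ^ 2) := by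
    rw [← (hdB d).diagonal_diag]
    congr 1
    ext i
    exact (hlam d i).2.symm
  have hh0 (d : ℕ) : 0 ≤ h d := by positivity
  have ht0 (d : ℕ) (i : Fin d) : 0 ≤ t d i := mul_nonneg (hh0 d) (sq_nonneg _)
  have htε (d : ℕ) (i : Fin d) : t d i ≤ ε d := step_mul_sq_le hκ hC (hlam0 d i) i (hbound d i).2
  have hε0 (d : ℕ) : 0 ≤ ε d := by positivity
  have hHm (d : ℕ) : Measurable (H d) := measurable_framePotential (hφmeas d)
  have hH1 (d : ℕ) : ∫ x, Real.exp (-H d x) ∂_root_.stdGaussian d = 1 :=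
    (integral_exp_neg_framePotential (hA d) (hVh d).1 (hB d) (hlam0 d) (hR d) (hφmeas d)).trans
      (hnorm d)
  have hm : ∀ᶠ d in atTop, ∀ x, m ≤ H d x := by
    filter_upwards [hlower] with d hd x
    simp only [hH, framePotential]
    rw [add_eigenFrame_mulVec (hVu d)]
    exact hd _
  have hr (a : ℝ) (ha : a ≤ max s (max s' s'')) : 4 * a - 2 ≤ 4 * max s (max s' s'') - 1 := by
    linarith
  have hΔ : Tendsto (fun d => ∫ ω, min 1 |H d ω.1 - H d (langevinProposal θ (t d) ω)| ^ 2
      ∂prodGaussian d) atTop (𝓝 0) := by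
    refine tendsto_integral_min_one_abs_sub_sq hθ tendsto_step_bound ht0 htε
      (u := fun d i => lam d i ^ (4 * s - 2)) (u' := fun d i => lam d i ^ (4 * s' - 2))
      (fun d i => Real.rpow_nonneg (hlam0 d i).le _) (fun d i => Real.rpow_nonneg (hlam0 d i).le _)
      (eventually_sum_rpow_le hc hlamc hA2 (hr s (le_max_left _ _))) ?_ hδloc ?_
    · obtain ⟨U, hU⟩ : ∃ U, ∀ᶠ d in atTop, ∑ i, lam d i ^ (4 * s' - 2) ≤ U :=
        ⟨_, eventually_sum_rpow_le hc hlamc hA2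
          (hr s' ((le_max_left _ _).trans (le_max_right _ _)))⟩
      have hUε : Tendsto (fun d => U * ε d) atTop (𝓝 0) := by
        simpa only [mul_zero] using tendsto_step_bound.const_mul U
      refine squeeze_zero' (Eventually.of_forall fun d => Finset.sum_nonneg fun i _ =>
        mul_nonneg (Real.rpow_nonneg (hlam0 d i).le _) (ht0 d i)) ?_ hUε
      filter_upwards [hU] with d hd
      calc _ ≤ ∑ i, lam d i ^ (4 * s' - 2) * ε d := Finset.sum_le_sum fun i _ =>
            mul_le_mul_of_nonneg_left (htε d i) (Real.rpow_nonneg (hlam0 d i).le _)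
        _ ≤ _ := by
            rw [← Finset.sum_mul]
            exact mul_le_mul_of_nonneg_right hd (hε0 d)
    · filter_upwards [hlip] with d hd
      exact abs_framePotential_sub_le (hVu d) (hQ d) (hlam0 d) hd
  have hw1 : ∀ᶠ d in atTop, w d ⬝ᵥ w d = 1 := by
    filter_upwards [eventually_gt_atTop i0] with d hd
    exact transpose_mulVec_dot_self (hQ d) (hqv d hd).2
  have hT := tendsto_sum_step_mul_sq_cube (l := l) hτ
  rw [← abs_mul_sqrt_pow_six_mul hl]
  constructor
  · refine (tendsto_integral_langevin_mhAccept hθ tendsto_step_bound hε0 ht0 htε hT hHm hH1 hm hΔ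
      hw1 (p := fun _ => 1) measurable_const (memLp_const 1) (by simp)).congr' ?_
    filter_upwards [eventually_gt_atTop 0] with d hd
    have := integral_glAccept_eq (V := V d) (hA d) (hVh d).1 (hVh d).2 (hQ d) (hB d) (hlam0 d)
      (hR d) hθ (step_pos (κ := κ) hl hd) (hφmeas d) (b := b d) (f := fun _ => 1) measurable_const
    simp only [one_mul] at this ⊢
    exact this.symm
  · have hlim := tendsto_integral_langevin_increment_sq hθ tendsto_step_bound hε0 ht0 htε hT hHm
      hH1 hm hΔ hw1 (s := σ) ?_ ?_ ?_
    · have hlim0 := hlim.sub_const (2 * Phi (-(|θ - 1 / 2| * √(l ^ 6 * τ) / 4)))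
      rw [sub_self] at hlim0
      have hne : ∀ᶠ d in atTop, h d ≠ 0 := by
        filter_upwards [eventually_gt_atTop 0] with d hd
        exact (step_pos hl hd).ne'
      refine (isLittleO_iff_tendsto' (hne.mono fun d hd h0 => absurd h0 hd)).mpr
        (hlim0.congr' ?_)
      filter_upwards [eventually_gt_atTop i0] with d hd
      have hd0 : 0 < h d := step_pos hl (by omega)
      have hl0 := hlam0 d ⟨i0, hd⟩
      have hf : Measurable fun v : Fin d → ℝ => (qv d ⬝ᵥ (Vh d)⁻¹ *ᵥ v) ^ 2 := by fun_prop
      have := integral_glAccept_eq (V := V d) (hA d) (hVh d).1 (hVh d).2 (hQ d) (hB d) (hlam0 d)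
        (hR d) hθ hd0 (hφmeas d) (b := b d) hf
      rw [this, eq_div_iff hd0.ne', sub_mul, ← integral_mul_const]
      congr 1
      · congr 1
        ext ω
        rw [dot_inv_mulVec_eigenFrame (hQ d) (hB d) (hVu d) (hlam0 d) (hqv d hd).1]
        simp only [hσ, dif_pos hd]
        field_simp
        rfl
      · ring
    · filter_upwards [eventually_gt_atTop i0] with d hd
      simp only [hσ, dif_pos hd]
      exact mul_pos (step_pos hl (by omega)) (pow_pos (hlam0 d _) 2)
    · filter_upwards [eventually_gt_atTop i0] with d hd
      simp only [hσ, dif_pos hd]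
      exact htε d _
    · filter_upwards [eventually_gt_atTop i0] with d hd i hi
      simp only [hσ, dif_pos hd, ht]
      rw [sq_eq_of_transpose_mulVec_ne_zero (hQ d) (hB d) (hqv d hd).1 i hi]
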